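/- arXiv:1706.03134 — 3 statements merged into one kernel-verified Lean document; each statement's English description precedes it below -/
import Mathlib

section
/- Suppose a = a(ε) is bounded and let u_{ε,a} be smooth solutions of ε²Δu + μ(x)u − |u|²u + εa f(x) = 0 on ℝ² that are uniformly bounded in L^∞(ℝ²). Then for every ρ₁ > ρ, the maps u_{ε,a}/ε and ∇u_{ε,a} are uniformly bounded on the set {x ∈ ℝ² : |x| ≥ ρ₁} for all sufficiently small ε. -/
open MeasureTheory Filter Real Set
open scoped Topology ENNReal

noncomputable section

/-- We identify the plane with the Euclidean space `ℝ²`. -/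
abbrev E2 : Type := EuclideanSpace ℝ (Fin 2)

/-- The standard basis vectors of `ℝ²`. -/
def e2basis (i : Fin 2) : E2 := EuclideanSpace.single i 1

/-- Rotation of a vector by `π/2` (multiplication by `i` in complex notation). -/
def perp (e : E2) : E2 := EuclideanSpace.single 0 (-(e 1)) + EuclideanSpace.single 1 (e 0)

/-- The unit vector `e^{iθ}`. -/
def uvec (θ : ℝ) : E2 := EuclideanSpace.single 0 (Real.cos θ) + EuclideanSpace.single 1 (Real.sin θ)

/-- The Laplacian of a map `u : ℝ² → ℝ²`. -/
def lap (u : E2 → E2) (x : E2) : E2 :=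
  ∑ i : Fin 2, fderiv ℝ (fun y => fderiv ℝ u y (e2basis i)) x (e2basis i)

/-- `|∇u|²`, the squared Hilbert-Schmidt norm of the full gradient of `u : ℝ² → ℝ²`. -/
def gradSq (u : E2 → E2) (x : E2) : ℝ := ∑ i : Fin 2, ‖fderiv ℝ u x (e2basis i)‖ ^ 2

/-- `∑_j ∇u_j · ∇ψ_j`, the Hilbert-Schmidt inner product of the gradients. -/
def gradInner (u ψ : E2 → E2) (x : E2) : ℝ :=
  ∑ i : Fin 2, (inner ℝ (fderiv ℝ u x (e2basis i)) (fderiv ℝ ψ x (e2basis i)) : ℝ)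

/-- Membership in `H¹(ℝ²,ℝ²)`: `u ∈ L²` together with its gradient. -/
def MemH1 (u : E2 → E2) : Prop :=
  Differentiable ℝ u ∧ MemLp u 2 (volume : Measure E2) ∧
    MemLp (fun x => fderiv ℝ u x) 2 (volume : Measure E2)

/-- The Ginzburg–Landau energy
`E(u) = ∫ (1/2)|∇u|² − (1/(2ε²))μ|u|² + (1/(4ε²))|u|⁴ − (a/ε) f·u`. -/
def energy (ε a : ℝ) (μ : E2 → ℝ) (f : E2 → E2) (u : E2 → E2) : ℝ :=
  ∫ x : E2, ((1/2) * gradSq u x - (1/(2*ε^2)) * μ x * ‖u x‖^2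
    + (1/(4*ε^2)) * ‖u x‖^4 - (a/ε) * (inner ℝ (f x) (u x) : ℝ))

/-- `v` is a global minimizer of `E` over `H¹(ℝ²,ℝ²)`. -/
def IsMinimizer (ε a : ℝ) (μ : E2 → ℝ) (f : E2 → E2) (v : E2 → E2) : Prop :=
  MemH1 v ∧ ∀ u : E2 → E2, MemH1 u → energy ε a μ f v ≤ energy ε a μ f u

/-- `u` is a smooth classical solution of the Euler–Lagrange equation
`ε²Δu + μu − |u|²u + εa f = 0` on `ℝ²`. -/
def IsSolution (ε a : ℝ) (μ : E2 → ℝ) (f : E2 → E2) (u : E2 → E2) : Prop :=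
  ContDiff ℝ (⊤ : ℕ∞) u ∧ ∀ x : E2, ε^2 • lap u x + μ x • u x - ‖u x‖^2 • u x + (ε*a) • f x = 0

/-- Hypotheses on the radial coefficient `μ`. -/
structure MuHyp (μ : E2 → ℝ) (μrad : ℝ → ℝ) (ρ : ℝ) : Prop where
  smooth : ContDiff ℝ (⊤ : ℕ∞) μ
  smooth_rad : ContDiff ℝ (⊤ : ℕ∞) μrad
  even_rad : ∀ r : ℝ, μrad (-r) = μrad r
  radial : ∀ x : E2, μ x = μrad ‖x‖
  bdd : ∃ C : ℝ, ∀ x : E2, |μ x| ≤ C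
  deriv_neg : ∀ r : ℝ, 0 < r → deriv μrad r < 0
  rho_pos : 0 < ρ
  rho_root : μrad ρ = 0
  rho_unique : ∀ r : ℝ, 0 < r → μrad r = 0 → r = ρ

/-- Hypotheses on the radial vector field `f`. -/
structure FHyp (f : E2 → E2) (frad : ℝ → ℝ) : Prop where
  smooth : ContDiff ℝ (⊤ : ℕ∞) f
  smooth_rad : ContDiff ℝ (⊤ : ℕ∞) frad
  odd_rad : ∀ r : ℝ, frad (-r) = -frad r
  radial : ∀ x : E2, x ≠ 0 → f x = (frad ‖x‖ / ‖x‖) • x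
  integrable : Integrable f (volume : Measure E2)
  bdd : ∃ C : ℝ, ∀ x : E2, ‖f x‖ ≤ C
  pos_rad : ∀ r : ℝ, 0 < r → 0 < frad r

/-- Convergence in `C²_loc(ℝ²,ℝ²)` of a sequence of maps. -/
def TendstoC2LocSeq (F : ℕ → E2 → E2) (g : E2 → E2) : Prop :=
  TendstoLocallyUniformly F g atTop ∧
  TendstoLocallyUniformly (fun n x => fderiv ℝ (F n) x) (fun x => fderiv ℝ g x) atTop ∧
  TendstoLocallyUniformly (fun n x => fderiv ℝ (fderiv ℝ (F n)) x)
    (fun x => fderiv ℝ (fderiv ℝ g) x) atTop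

/-- `l` is a limit point (as `ε → 0`) of the set of zeros of the family `v ε`. -/
def IsZeroLimitPoint (v : ℝ → E2 → E2) (l : E2) : Prop :=
  ∃ (εs : ℕ → ℝ) (xs : ℕ → E2), (∀ n, 0 < εs n) ∧ Tendsto εs atTop (𝓝 (0:ℝ)) ∧
    (∀ n, v (εs n) (xs n) = 0) ∧ Tendsto xs atTop (𝓝 l)

/-- At an interior maximum along a line the second derivative is nonpositive. -/
lemma second_deriv_nonpos (g g' : ℝ → ℝ) (c t : ℝ) (h1 : ∀ s, HasDerivAt g (g' s) s)
    (h2 : HasDerivAt g' c t) (hm : IsLocalMax g t) : c ≤ 0 := by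
  by_contra hc
  push Not at hc
  have hd : deriv g = g' := funext fun s => (h1 s).deriv
  have h0 : deriv g t = 0 := hm.deriv_eq_zero
  have hmin : IsLocalMin g t := by
    apply isLocalMin_of_deriv_deriv_pos _ h0 (h1 t).continuousAt
    rw [hd, h2.deriv]; exact hc
  have hconst : g =ᶠ[𝓝 t] fun _ => g t := by
    filter_upwards [hm, hmin] with s a b
    exact le_antisymm a b
  have h3 : deriv g =ᶠ[𝓝 t] fun _ => 0 := by
    have := hconst.deriv
    simpa using this
  have h4 : deriv (deriv g) t = 0 := by
    rw [h3.deriv_eq]; simp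
  rw [hd, h2.deriv] at h4
  linarith

/-- Weak maximum principle on a rectangle. -/
lemma rect_mp (g g1 g11 g2 g22 : ℝ → ℝ → ℝ) (a b c d : ℝ)
    (hg : Continuous (fun p : ℝ × ℝ => g p.1 p.2))
    (h1 : ∀ s t, HasDerivAt (fun s => g s t) (g1 s t) s)
    (h11 : ∀ s t, HasDerivAt (fun s => g1 s t) (g11 s t) s)
    (h2 : ∀ s t, HasDerivAt (fun t => g s t) (g2 s t) t)
    (h22 : ∀ s t, HasDerivAt (fun t => g2 s t) (g22 s t) t)
    (ha : ∀ t ∈ Icc c d, g a t ≤ 0) (hb : ∀ t ∈ Icc c d, g b t ≤ 0)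
    (hc : ∀ s ∈ Icc a b, g s c ≤ 0) (hd : ∀ s ∈ Icc a b, g s d ≤ 0)
    (hint : ∀ s ∈ Icc a b, ∀ t ∈ Icc c d, 0 < g s t → 0 < g11 s t + g22 s t) :
    ∀ s ∈ Icc a b, ∀ t ∈ Icc c d, g s t ≤ 0 := by
  intro s hs t ht
  obtain ⟨⟨s0, t0⟩, ⟨hs0, ht0⟩, hmax⟩ :=
    (isCompact_Icc.prod isCompact_Icc : IsCompact (Icc a b ×ˢ Icc c d)).exists_isMaxOn
      ⟨(s, t), hs, ht⟩ hg.continuousOn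
  have hle : ∀ s' ∈ Icc a b, ∀ t' ∈ Icc c d, g s' t' ≤ g s0 t0 :=
    fun s' hs' t' ht' => hmax (show (s', t') ∈ _ from ⟨hs', ht'⟩)
  refine (hle s hs t ht).trans ?_
  by_contra hpos
  push Not at hpos
  simp only at hs0 ht0
  have e1 : s0 ≠ a := by rintro rfl; linarith [ha t0 ht0]
  have e2 : s0 ≠ b := by rintro rfl; linarith [hb t0 ht0]
  have e3 : t0 ≠ c := by rintro rfl; linarith [hc s0 hs0]
  have e4 : t0 ≠ d := by rintro rfl; linarith [hd s0 hs0]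
  have k1 : g11 s0 t0 ≤ 0 := by
    apply second_deriv_nonpos (fun s => g s t0) (fun s => g1 s t0) _ s0 (fun s => h1 s t0)
      (h11 s0 t0)
    filter_upwards [Icc_mem_nhds (lt_of_le_of_ne hs0.1 (Ne.symm e1)) (lt_of_le_of_ne hs0.2 e2)]
      with s' hs' using hle s' hs' t0 ht0
  have k2 : g22 s0 t0 ≤ 0 := by
    apply second_deriv_nonpos (fun t => g s0 t) (fun t => g2 s0 t) _ t0 (fun t => h2 s0 t)
      (h22 s0 t0)
    filter_upwards [Icc_mem_nhds (lt_of_le_of_ne ht0.1 (Ne.symm e3)) (lt_of_le_of_ne ht0.2 e4)]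
      with t' ht' using hle s0 hs0 t' ht'
  linarith [hint s0 hs0 t0 ht0 hpos]

/-- First partial derivative. -/
def pd (i : Fin 2) (u : E2 → E2) (y : E2) : E2 := fderiv ℝ u y (e2basis i)

lemma pd_smooth {u : E2 → E2} (hu : ContDiff ℝ (⊤ : ℕ∞) u) (i : Fin 2) :
    ContDiff ℝ (⊤ : ℕ∞) (pd i u) := by
  unfold pd
  exact (hu.fderiv_right (m := (⊤ : ℕ∞)) (by exact_mod_cast le_refl _)).clm_apply contDiff_const

lemma pd_line {u : E2 → E2} (hu : ContDiff ℝ (⊤ : ℕ∞) u) (i : Fin 2) (p : E2) (t : ℝ) :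
    HasDerivAt (fun t : ℝ => u (p + t • e2basis i)) (pd i u (p + t • e2basis i)) t := by
  have h1 : HasDerivAt (fun t : ℝ => p + t • e2basis i) (e2basis i) t := by
    simpa using ((hasDerivAt_id t).smul_const (e2basis i)).const_add p
  exact ((hu.differentiable (by simp)) _).hasFDerivAt.comp_hasDerivAt t h1

lemma pd_line' {u : E2 → E2} (hu : ContDiff ℝ (⊤ : ℕ∞) u) (i j : Fin 2) (p : E2) (s t : ℝ) :
    HasDerivAt (fun s : ℝ => u (p + s • e2basis j + t • e2basis i))
      (pd j u (p + s • e2basis j + t • e2basis i)) s := by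
  have := pd_line hu j (p + t • e2basis i) s
  simpa only [add_right_comm p] using this

lemma lap_eq (u : E2 → E2) (x : E2) : lap u x = pd 0 (pd 0 u) x + pd 1 (pd 1 u) x := by
  simp [lap, pd, Fin.sum_univ_two]; rfl

lemma norm_e2basis (i : Fin 2) : ‖e2basis i‖ = 1 := by simp [e2basis]

lemma dist_sq_pt (p : E2) (i j : Fin 2) (s t d : ℝ) (hs : |s| ≤ d) (ht : |t| ≤ d) :
    ‖p‖ - 2 * d ≤ ‖p + s • e2basis j + t • e2basis i‖ := by
  have h1 : ‖s • e2basis j + t • e2basis i‖ ≤ 2 * d := by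
    refine (norm_add_le _ _).trans ?_
    rw [norm_smul, norm_smul, norm_e2basis, norm_e2basis, Real.norm_eq_abs, Real.norm_eq_abs]
    linarith
  have h2 := norm_sub_norm_le p (-(s • e2basis j + t • e2basis i))
  rw [norm_neg, sub_neg_eq_add, ← add_assoc] at h2
  linarith

/-- Interior gradient estimate by comparison. -/
lemma grad_est {u : E2 → E2} (hu : ContDiff ℝ (⊤ : ℕ∞) u) (i j : Fin 2) (p e : E2)
    (he : ‖e‖ ≤ 1) (d N F : ℝ) (hd : 0 < d)
    (hN : ∀ s t, |s| ≤ d → |t| ≤ d → ‖u (p + s • e2basis j + t • e2basis i)‖ ≤ N)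
    (hF : ∀ s t, |s| ≤ d → |t| ≤ d →
      ‖pd j (pd j u) (p + s • e2basis j + t • e2basis i) +
        pd i (pd i u) (p + s • e2basis j + t • e2basis i)‖ < F) :
    inner ℝ (pd i u p) e ≤ 2 * N / d + F * d / 2 := by
  let P : ℝ → ℝ → E2 := fun s t => p + s • e2basis j + t • e2basis i
  let v : ℝ → ℝ → ℝ := fun s t => inner ℝ (u (P s t)) e
  have key : ∀ (w : E2 → E2), ContDiff ℝ (⊤ : ℕ∞) w → ∀ s t : ℝ,
      HasDerivAt (fun s => inner ℝ (w (P s t)) e : ℝ → ℝ) (inner ℝ (pd j w (P s t)) e) s ∧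
      HasDerivAt (fun t => inner ℝ (w (P s t)) e : ℝ → ℝ) (inner ℝ (pd i w (P s t)) e) t := by
    intro w hw s t
    constructor
    · have := (pd_line' hw i j p s t).inner ℝ (hasDerivAt_const s e)
      simpa using this
    · have := (pd_line hw i (p + s • e2basis j) t).inner ℝ (hasDerivAt_const t e)
      simpa using this
  have keyn : ∀ (w : E2 → E2), ContDiff ℝ (⊤ : ℕ∞) w → ∀ s t : ℝ,
      HasDerivAt (fun t => inner ℝ (w (P s (-t))) e : ℝ → ℝ) (-inner ℝ (pd i w (P s (-t))) e) t := by
    intro w hw s t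
    have := (key w hw s (-t)).2.scomp t (hasDerivAt_neg t)
    simpa [Function.comp_def] using this
  have absI : ∀ z : E2, |inner ℝ z e| ≤ ‖z‖ := fun z => by
    refine (abs_real_inner_le_norm z e).trans ?_
    nlinarith [norm_nonneg z]
  have hN0 : 0 ≤ N := (norm_nonneg _).trans (hN 0 0 (by simp [hd.le]) (by simp [hd.le]))
  have hF0 : 0 ≤ F := (norm_nonneg _).trans (hF 0 0 (by simp [hd.le]) (by simp [hd.le])).le
  have hvN : ∀ s t, |s| ≤ d → |t| ≤ d → |v s t| ≤ N :=
    fun s t a b => (absI _).trans (hN s t a b)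
  have hcont : Continuous (fun q : ℝ × ℝ => v q.1 q.2) := by
    have := hu.continuous
    simp only [v, P]
    fun_prop
  have hcont' : Continuous (fun q : ℝ × ℝ => v q.1 (-q.2)) :=
    hcont.comp (by fun_prop : Continuous (fun q : ℝ × ℝ => (q.1, -q.2)))
  set α := N / d ^ 2 with hα
  have hα0 : 0 ≤ α := by positivity
  have hαd : α * d ^ 2 = N := by rw [hα]; field_simp
  have main := rect_mp
    (fun s t => (v s t - v s (-t)) / 2 - (α * (s ^ 2 + t * (2 * d - t)) + F / 2 * (t * (d - t))))
    (fun s t => (inner ℝ (pd j u (P s t)) e - inner ℝ (pd j u (P s (-t))) e) / 2 - α * (2 * s))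
    (fun s t => (inner ℝ (pd j (pd j u) (P s t)) e - inner ℝ (pd j (pd j u) (P s (-t))) e) / 2
      - α * 2)
    (fun s t => (inner ℝ (pd i u (P s t)) e + inner ℝ (pd i u (P s (-t))) e) / 2
      - (α * (2 * d - 2 * t) + F / 2 * (d - 2 * t)))
    (fun s t => (inner ℝ (pd i (pd i u) (P s t)) e - inner ℝ (pd i (pd i u) (P s (-t))) e) / 2
      - (α * (-2) + F / 2 * (-2)))
    (-d) d 0 d (by fun_prop) ?_ ?_ ?_ ?_ ?_ ?_ ?_ ?_ ?_
  · -- conclusion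
    have hdv : HasDerivAt (fun t => (v 0 t - v 0 (-t)) / 2
        - (α * (0 ^ 2 + t * (2 * d - t)) + F / 2 * (t * (d - t))))
        (inner ℝ (pd i u p) e - (2 * N / d + F * d / 2)) 0 := by
      have A := ((key u hu 0 0).2.sub (keyn u hu 0 0)).div_const 2
      have B : HasDerivAt (fun t : ℝ => α * (0 ^ 2 + t * (2 * d - t)) + F / 2 * (t * (d - t)))
          (α * (2 * d) + F / 2 * d) 0 := by
        have hi := hasDerivAt_id (0:ℝ)
        have := (((hi.mul (hi.const_sub (2 * d))).const_add (0 ^ 2)).const_mul α).add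
          ((hi.mul (hi.const_sub d)).const_mul (F / 2))
        refine HasDerivAt.congr_deriv this ?_
        simp
      refine HasDerivAt.congr_deriv (A.sub B) ?_
      have hp : P 0 0 = p := by simp [P]
      simp only [neg_zero, hp, hα]
      field_simp
      ring
    by_contra hcon
    push Not at hcon
    have hpos := (hasDerivAt_iff_tendsto_slope.1 hdv).eventually
      (lt_mem_nhds (show (0:ℝ) < _ by linarith))
    have hpos' := hpos.filter_mono (nhdsWithin_mono (0:ℝ) (fun t (ht : t ∈ Ioi (0:ℝ)) => ne_of_gt ht))
    have hev : ∀ᶠ t in 𝓝[>] (0:ℝ), t ∈ Ioo 0 d := Ioo_mem_nhdsGT hd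
    obtain ⟨t, ht1, ht2⟩ := (hpos'.and hev).exists
    have hm := main 0 ⟨by linarith, hd.le⟩ t ⟨ht2.1.le, ht2.2.le⟩
    simp only [slope_def_field] at ht1
    have := (div_pos_iff_of_pos_right (by linarith [ht2.1] : (0:ℝ) < t - 0)).1 ht1
    simp at this hm
    linarith
  · intro s t
    have hi := hasDerivAt_id s
    have := (((key u hu s t).1.sub (key u hu s (-t)).1).div_const 2).sub
      ((((hasDerivAt_pow 2 s).add_const (t * (2 * d - t))).const_mul α).add_const
        (F / 2 * (t * (d - t))))
    refine HasDerivAt.congr_deriv this ?_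
    simp
  · intro s t
    have hi := ((hasDerivAt_id s).const_mul 2).const_mul α
    have := (((key _ (pd_smooth hu j) s t).1.sub (key _ (pd_smooth hu j) s (-t)).1).div_const 2).sub hi
    refine HasDerivAt.congr_deriv this ?_
    simp
  · intro s t
    have hi := hasDerivAt_id t
    have := (((key u hu s t).2.sub (keyn u hu s t)).div_const 2).sub
      ((((hi.mul (hi.const_sub (2 * d))).const_add (s ^ 2)).const_mul α).add
          ((hi.mul (hi.const_sub d)).const_mul (F / 2)))
    refine HasDerivAt.congr_deriv this ?_
    simp
    ring
  · intro s t
    have hi := (hasDerivAt_id t).const_mul 2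
    have := (((key _ (pd_smooth hu i) s t).2.add (keyn _ (pd_smooth hu i) s t)).div_const 2).sub
      (((hi.const_sub (2 * d)).const_mul α).add ((hi.const_sub d).const_mul (F / 2)))
    refine HasDerivAt.congr_deriv this ?_
    simp
    ring
  · intro t ht
    have h1 := abs_le.1 (hvN (-d) t (by simp [abs_of_pos hd]) (abs_le.2 ⟨by linarith [ht.1], ht.2⟩))
    have h2 := abs_le.1 (hvN (-d) (-t) (by simp [abs_of_pos hd])
      (by rw [abs_neg]; exact (abs_le.2 ⟨by linarith [ht.1], ht.2⟩)))
    have h3 : 0 ≤ α * (t * (2 * d - t)) :=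
      mul_nonneg hα0 (mul_nonneg ht.1 (by linarith [ht.2]))
    have h4 : 0 ≤ F / 2 * (t * (d - t)) :=
      mul_nonneg (by linarith) (mul_nonneg ht.1 (by linarith [ht.2]))
    nlinarith
  · intro t ht
    have h1 := abs_le.1 (hvN d t (by simp [abs_of_pos hd]) (abs_le.2 ⟨by linarith [ht.1], ht.2⟩))
    have h2 := abs_le.1 (hvN d (-t) (by simp [abs_of_pos hd])
      (by rw [abs_neg]; exact (abs_le.2 ⟨by linarith [ht.1], ht.2⟩)))
    have h3 : 0 ≤ α * (t * (2 * d - t)) :=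
      mul_nonneg hα0 (mul_nonneg ht.1 (by linarith [ht.2]))
    have h4 : 0 ≤ F / 2 * (t * (d - t)) :=
      mul_nonneg (by linarith) (mul_nonneg ht.1 (by linarith [ht.2]))
    nlinarith
  · intro s hs
    have : 0 ≤ α * s ^ 2 := by positivity
    simp
    linarith
  · intro s hs
    have h1 := abs_le.1 (hvN s d (abs_le.2 hs) (by simp [abs_of_pos hd]))
    have h2 := abs_le.1 (hvN s (-d) (abs_le.2 hs) (by simp [abs_of_pos hd]))
    have : 0 ≤ α * s ^ 2 := by positivity
    nlinarith
  · intro s hs t ht _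
    have ht' : |t| ≤ d := abs_le.2 ⟨by linarith [ht.1], ht.2⟩
    have h1 := (absI _).trans_lt (hF s t (abs_le.2 hs) ht')
    have h2 := (absI _).trans_lt (hF s (-t) (abs_le.2 hs) (by rwa [abs_neg]))
    rw [inner_add_left] at h1 h2
    have h1 := abs_lt.1 h1
    have h2 := abs_lt.1 h2
    simp only [P]
    linarith

set_option maxHeartbeats 1000000 in
/-- Local decay of the solution. -/
lemma sup_est {u f : E2 → E2} {μ : E2 → ℝ} {ε a C Cf m M η : ℝ} (hε : 0 < ε) (ha : 0 ≤ a)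
    (haC : a ≤ C) (hm : 0 < m) (hη : 0 < η) (hf : ∀ x, ‖f x‖ ≤ Cf)
    (hu : IsSolution ε a μ f u) (hM : ∀ x, ‖u x‖ ≤ M) (p : E2)
    (hμ : ∀ s t, |s| ≤ η → |t| ≤ η →
      μ (p + s • e2basis 0 + t • e2basis 1) ≤ -m) :
    ‖u p‖ ^ 2 ≤ ε ^ 2 * ((C * Cf) ^ 2 / m ^ 2 + 4 * (M / η) ^ 2 / m) := by
  obtain ⟨hs, heq⟩ := hu
  let P : ℝ → ℝ → E2 := fun s t => p + s • e2basis 0 + t • e2basis 1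
  have hM0 : 0 ≤ M := (norm_nonneg _).trans (hM p)
  have hCf0 : 0 ≤ Cf := (norm_nonneg _).trans (hf p)
  have hC0 : 0 ≤ C := ha.trans haC
  set A := ε ^ 2 * ((C * Cf) ^ 2 / m ^ 2 + 4 * (M / η) ^ 2 / m) with hA
  set β := (M / η) ^ 2 with hβ
  have hβη : β * η ^ 2 = M ^ 2 := by rw [hβ]; field_simp
  have hβ0 : 0 ≤ β := by positivity
  have hA0 : 0 ≤ A := by positivity
  have hsq : ∀ x, ‖u x‖ ^ 2 ≤ M ^ 2 := fun x => by
    have := hM x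
    gcongr
  have hcont : Continuous (fun q : ℝ × ℝ => ‖u (P q.1 q.2)‖ ^ 2) := by
    have := hs.continuous
    simp only [P]
    fun_prop
  have main := rect_mp
    (fun s t => ‖u (P s t)‖ ^ 2 - (A + β * (s ^ 2 + t ^ 2)))
    (fun s t => 2 * inner ℝ (u (P s t)) (pd 0 u (P s t)) - β * (2 * s))
    (fun s t => 2 * (inner ℝ (u (P s t)) (pd 0 (pd 0 u) (P s t)) +
      inner ℝ (pd 0 u (P s t)) (pd 0 u (P s t))) - β * 2)
    (fun s t => 2 * inner ℝ (u (P s t)) (pd 1 u (P s t)) - β * (2 * t))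
    (fun s t => 2 * (inner ℝ (u (P s t)) (pd 1 (pd 1 u) (P s t)) +
      inner ℝ (pd 1 u (P s t)) (pd 1 u (P s t))) - β * 2)
    (-η) η (-η) η (by fun_prop) ?_ ?_ ?_ ?_ ?_ ?_ ?_ ?_ ?_
  · have := main 0 ⟨by linarith, hη.le⟩ 0 ⟨by linarith, hη.le⟩
    simp [P] at this
    exact this
  · intro s t
    have := (pd_line' hs 1 0 p s t).norm_sq.sub
      ((((hasDerivAt_pow 2 s).add_const (t ^ 2)).const_mul β).const_add A)
    refine HasDerivAt.congr_deriv this ?_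
    simp [P]
  · intro s t
    have := (((pd_line' hs 1 0 p s t).inner ℝ (pd_line' (pd_smooth hs 0) 1 0 p s t)).const_mul 2).sub
      (((hasDerivAt_id s).const_mul 2).const_mul β)
    refine HasDerivAt.congr_deriv this ?_
    simp [P]
  · intro s t
    have := (pd_line hs 1 (p + s • e2basis 0) t).norm_sq.sub
      ((((hasDerivAt_pow 2 t).const_add (s ^ 2)).const_mul β).const_add A)
    refine HasDerivAt.congr_deriv this ?_
    simp [P]
  · intro s t
    have := (((pd_line hs 1 (p + s • e2basis 0) t).inner ℝ
      (pd_line (pd_smooth hs 1) 1 (p + s • e2basis 0) t)).const_mul 2).sub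
      (((hasDerivAt_id t).const_mul 2).const_mul β)
    refine HasDerivAt.congr_deriv this ?_
    simp [P]
  · intro t _
    nlinarith [hsq (P (-η) t), mul_nonneg hβ0 (sq_nonneg t)]
  · intro t _
    nlinarith [hsq (P η t), mul_nonneg hβ0 (sq_nonneg t)]
  · intro t _
    nlinarith [hsq (P t (-η)), mul_nonneg hβ0 (sq_nonneg t)]
  · intro t _
    nlinarith [hsq (P t η), mul_nonneg hβ0 (sq_nonneg t)]
  · intro s hs' t ht' hpos
    have hμ' := hμ s t (abs_le.2 hs') (abs_le.2 ht')
    change μ (P s t) ≤ -m at hμ'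
    have heq' := congrArg (fun z => (inner ℝ (u (P s t)) z : ℝ)) (heq (P s t))
    simp only [lap_eq, inner_add_right, inner_sub_right, inner_smul_right, inner_zero_right,
      real_inner_self_eq_norm_sq] at heq'
    simp only [real_inner_self_eq_norm_sq]
    set X := P s t
    set w := ‖u X‖ with hw
    set L := (inner ℝ (u X) (pd 0 (pd 0 u) X) + inner ℝ (u X) (pd 1 (pd 1 u) X) : ℝ) with hL
    have hfi : inner ℝ (u X) (f X) ≤ w * Cf :=
      (real_inner_le_norm _ _).trans (by gcongr; exact hf X)
    have hw0 : 0 ≤ w := norm_nonneg _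
    have h1 : ε * a * inner ℝ (u X) (f X) ≤ ε * (C * Cf) * w := by
      calc ε * a * inner ℝ (u X) (f X) ≤ ε * a * (w * Cf) := by gcongr
        _ ≤ ε * C * (w * Cf) := by gcongr
        _ = _ := by ring
    have h2 : m * w ^ 2 ≤ -μ X * w ^ 2 := by
      have := sq_nonneg w
      nlinarith
    have h3 : m * w ^ 2 - ε * (C * Cf) * w ≤ ε ^ 2 * L := by nlinarith [sq_nonneg (w ^ 2)]
    have h4 : m * A = ε ^ 2 * (C * Cf) ^ 2 / m + 4 * ε ^ 2 * β := by
      rw [hA]; field_simp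
    have h5 : 2 * (ε * (C * Cf) * w) ≤ m * w ^ 2 + ε ^ 2 * (C * Cf) ^ 2 / m := by
      have : m * w ^ 2 + ε ^ 2 * (C * Cf) ^ 2 / m - 2 * (ε * (C * Cf) * w)
        = (m * w - ε * (C * Cf)) ^ 2 / m := by field_simp; ring
      have h6 : 0 ≤ (m * w - ε * (C * Cf)) ^ 2 / m := by positivity
      linarith
    have h7 : A < w ^ 2 := by nlinarith [mul_nonneg hβ0 (sq_nonneg s), mul_nonneg hβ0 (sq_nonneg t)]
    have h8 : m * A < m * w ^ 2 := by gcongr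
    have h9 : 0 < ε ^ 2 * (2 * L - 4 * β) := by nlinarith
    have h10 : 0 < 2 * L - 4 * β := pos_of_mul_pos_right h9 (by positivity)
    have h11 := sq_nonneg ‖pd 0 u X‖
    have h12 := sq_nonneg ‖pd 1 u X‖
    rw [hL] at h10
    linarith

lemma fderiv_norm_le {u : E2 → E2} (x : E2) (B : ℝ) (hB : ∀ i, ‖pd i u x‖ ≤ B) :
    ‖fderiv ℝ u x‖ ≤ 2 * B := by
  have hB0 : 0 ≤ B := (norm_nonneg _).trans (hB 0)
  refine ContinuousLinearMap.opNorm_le_bound _ (by positivity) fun v => ?_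
  have hv : v = v 0 • e2basis 0 + v 1 • e2basis 1 := by
    ext k; fin_cases k <;> simp [e2basis]
  have h : fderiv ℝ u x v = v 0 • pd 0 u x + v 1 • pd 1 u x := by
    conv_lhs => rw [hv]
    simp [pd]
  rw [h]
  refine (norm_add_le _ _).trans ?_
  rw [norm_smul, norm_smul]
  have h0 := PiLp.norm_apply_le v 0
  have h1 := PiLp.norm_apply_le v 1
  have := mul_le_mul h0 (hB 0) (norm_nonneg _) (norm_nonneg _)
  have := mul_le_mul h1 (hB 1) (norm_nonneg _) (norm_nonneg _)
  linarith

lemma norm_le_of_inner {z : E2} {B : ℝ} (hB : 0 ≤ B)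
    (h : ∀ e : E2, ‖e‖ ≤ 1 → inner ℝ z e ≤ B) : ‖z‖ ≤ B := by
  by_cases hz : z = 0
  · simpa [hz] using hB
  have hz' : ‖z‖ ≠ 0 := norm_ne_zero_iff.2 hz
  have := h (‖z‖⁻¹ • z) (by rw [norm_smul, norm_inv, norm_norm, inv_mul_cancel₀ hz'])
  rw [inner_smul_right, real_inner_self_eq_norm_sq] at this
  rwa [sq, inv_mul_cancel_left₀ hz'] at this

/-- for bounded `a` and uniformly bounded smooth solutions, the maps
`u_{ε,a}/ε` and `∇u_{ε,a}` are uniformly bounded on `{|x| ≥ ρ₁}` for `ρ₁ > ρ` and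
`ε` small. -/
theorem statement11
    (μ : E2 → ℝ) (μrad : ℝ → ℝ) (ρ : ℝ) (f : E2 → E2) (frad : ℝ → ℝ)
    (hμ : MuHyp μ μrad ρ) (hf : FHyp f frad)
    (C M : ℝ) (ρ1 : ℝ) (hρ1 : ρ < ρ1) :
    ∃ K : ℝ, ∃ ε₀ : ℝ, 0 < ε₀ ∧
      ∀ (ε a : ℝ) (u : E2 → E2), 0 < ε → ε < ε₀ → 0 ≤ a → a ≤ C →
        IsSolution ε a μ f u → (∀ x : E2, ‖u x‖ ≤ M) →
        ∀ x : E2, ρ1 ≤ ‖x‖ → ‖u x‖ / ε ≤ K ∧ ‖fderiv ℝ u x‖ ≤ K := by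
  obtain ⟨Cμ, hCμ⟩ := hμ.bdd
  obtain ⟨Cf, hCf⟩ := hf.bdd
  have hanti : StrictAntiOn μrad (Ioi 0) := by
    apply strictAntiOn_of_deriv_neg (convex_Ioi 0) hμ.smooth_rad.continuous.continuousOn
    intro r hr
    rw [interior_Ioi] at hr
    exact hμ.deriv_neg r hr
  have hρ := hμ.rho_pos
  set ρ0 := (ρ + ρ1) / 2 with hρ0
  have h01 : ρ < ρ0 := by rw [hρ0]; linarith
  have h02 : ρ0 < ρ1 := by rw [hρ0]; linarith
  set m := -μrad ρ0 with hm
  have hmpos : 0 < m := by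
    have := hanti (show ρ ∈ Ioi 0 from hρ) (show ρ0 ∈ Ioi 0 from hρ.trans h01) h01
    rw [hμ.rho_root] at this
    linarith
  have hμm : ∀ x : E2, ρ0 ≤ ‖x‖ → μ x ≤ -m := by
    intro x hx
    rw [hμ.radial, hm, neg_neg]
    exact hanti.antitoneOn (show ρ0 ∈ Ioi 0 from hρ.trans h01)
      (show ‖x‖ ∈ Ioi 0 from (hρ.trans h01).trans_le hx) hx
  set η := (ρ1 - ρ0) / 4 with hη
  have hηpos : 0 < η := by rw [hη]; linarith
  set K1 := √((C * Cf) ^ 2 / m ^ 2 + 4 * (M / η) ^ 2 / m) with hK1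
  have hK10 : 0 ≤ K1 := Real.sqrt_nonneg _
  have hK1sq : K1 ^ 2 = (C * Cf) ^ 2 / m ^ 2 + 4 * (M / η) ^ 2 / m :=
    Real.sq_sqrt (by positivity)
  have hCμ0 : 0 ≤ Cμ := (abs_nonneg _).trans (hCμ 0)
  have hCf0 : 0 ≤ Cf := (norm_nonneg _).trans (hCf 0)
  set G := Cμ * K1 + M ^ 2 * K1 + |C| * Cf + 1 with hG
  have hG0 : 0 < G := by positivity
  refine ⟨2 * (2 * K1 + G / 2), η, hηpos, ?_⟩
  intro ε a u hε hεη ha haC hu hM x hx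
  have hsup : ∀ y : E2, ρ0 + 2 * η ≤ ‖y‖ → ‖u y‖ ≤ ε * K1 := by
    intro y hy
    have h := sup_est (η := η) (m := m) hε ha haC hmpos hηpos hCf hu hM y (fun s t hs ht =>
      hμm _ (by linarith [dist_sq_pt y 1 0 s t η hs ht]))
    rw [← hK1sq, ← mul_pow] at h
    exact le_of_sq_le_sq h (by positivity)
  have hlap : ∀ y : E2, ρ0 + 2 * η ≤ ‖y‖ → ‖lap u y‖ < G / ε := by
    intro y hy
    have h1 := hsup y hy
    have h2 : ε ^ 2 • lap u y = -(μ y • u y) + ‖u y‖ ^ 2 • u y - (ε * a) • f y := by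
      have := hu.2 y
      rw [← sub_eq_zero, ← this]; abel
    have h3 : ‖ε ^ 2 • lap u y‖ ≤ Cμ * (ε * K1) + M ^ 2 * (ε * K1) + ε * |C| * Cf := by
      rw [h2]
      refine (norm_sub_le _ _).trans (add_le_add ((norm_add_le _ _).trans (add_le_add ?_ ?_)) ?_)
      · rw [norm_neg, norm_smul]
        exact mul_le_mul (hCμ y) h1 (norm_nonneg _) hCμ0
      · rw [norm_smul, norm_pow, norm_norm]
        have := hM y
        gcongr
      · rw [norm_smul, Real.norm_eq_abs, abs_of_nonneg (by positivity)]
        have := hCf y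
        have := haC.trans (le_abs_self C)
        gcongr
    rw [norm_smul, Real.norm_eq_abs, abs_of_nonneg (by positivity)] at h3
    rw [lt_div_iff₀ hε]
    have h4 : ε * (‖lap u y‖ * ε) < ε * G := by
      rw [hG]; nlinarith
    exact lt_of_mul_lt_mul_left h4 hε.le
  have hxρ : ρ0 + 4 * η ≤ ‖x‖ := by rw [hη]; linarith
  constructor
  · rw [div_le_iff₀ hε]
    nlinarith [hsup x (by linarith), mul_nonneg hε.le hK10, mul_pos hε hG0]
  · apply fderiv_norm_le
    have hpt : ∀ (i j : Fin 2) (s t : ℝ), |s| ≤ ε → |t| ≤ ε →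
        ρ0 + 2 * η ≤ ‖x + s • e2basis j + t • e2basis i‖ := fun i j s t hs ht => by
      linarith [dist_sq_pt x i j s t ε hs ht]
    have hval : 2 * (ε * K1) / ε + G / ε * ε / 2 = 2 * K1 + G / 2 := by field_simp
    intro i
    refine norm_le_of_inner (by positivity) fun e he => ?_
    rw [← hval]
    fin_cases i
    · refine grad_est hu.1 0 1 x e he ε (ε * K1) (G / ε) hε
        (fun s t hs ht => hsup _ (hpt 0 1 s t hs ht)) (fun s t hs ht => ?_)
      rw [add_comm, ← lap_eq]
      exact hlap _ (hpt 0 1 s t hs ht)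
    · refine grad_est hu.1 1 0 x e he ε (ε * K1) (G / ε) hε
        (fun s t hs ht => hsup _ (hpt 1 0 s t hs ht)) (fun s t hs ht => ?_)
      rw [← lap_eq]
      exact hlap _ (hpt 1 0 s t hs ht)
end
end

section
/- Fix ρ₁ > ρ, τ > 0 and γ ∈ [0,2/3), and consider the annulus A = {x : ρ + τε^γ ≤ |x| ≤ ρ₁}. Assume a = a(ε) > 0 with lim_{ε→0} ε^{1−3γ/2} ln a = 0, and let u_{ε,a} be smooth solutions of ε²Δu + μ(x)u − |u|²u + εa f(x) = 0 on ℝ² that are uniformly bounded in L^∞(ℝ²). Then there exists ε₀ > 0 such that for every ε < ε₀, u_{ε,a}(x) ≠ 0 for all x ∈ A; moreover u_{ε,a}(x)/|u_{ε,a}(x)| → x/|x| uniformly on A as ε → 0, and for sufficiently small ε the solution u_{ε,a} has at least one zero in the open disc {|x| < ρ + τε^γ}. -/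
open MeasureTheory Filter Real Set
open scoped Topology ENNReal

noncomputable section

lemma second_deriv_nonneg (g g' : ℝ → ℝ) (c : ℝ) (h1 : ∀ t, HasDerivAt g (g' t) t)
    (h2 : HasDerivAt g' c 0) (hmin : IsLocalMin g 0) : 0 ≤ c := by
  by_contra hc
  push Not at hc
  have hd : deriv g = g' := funext fun t => (h1 t).deriv
  have h0 : g' 0 = 0 := by
    have := hmin.deriv_eq_zero
    rwa [hd] at this
  have hmax : IsLocalMax g 0 := by
    apply isLocalMax_of_deriv_deriv_neg
    · rw [hd, h2.deriv]; exact hc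
    · rw [hd]; exact h0
    · exact (h1 0).continuousAt
  have hev : g =ᶠ[𝓝 0] fun _ => g 0 := by
    filter_upwards [hmin, hmax] with t ht1 ht2
    exact le_antisymm ht2 ht1
  have h3 : deriv g =ᶠ[𝓝 0] deriv (fun _ => g 0) := hev.deriv
  have h4 : deriv (deriv g) 0 = deriv (deriv (fun _ : ℝ => g 0)) 0 := h3.deriv_eq
  rw [hd, h2.deriv] at h4
  simp at h4
  linarith

lemma complex_zero (G : ℂ → ℂ) (hG : Continuous G) (r : ℝ) (hr : 0 < r)
    (hb : ∀ z : ℂ, ‖z‖ = r → 0 < (G z * (starRingEnd ℂ) z).re) :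
    ∃ z : ℂ, ‖z‖ < r ∧ G z = 0 := by
  by_contra hcon
  push Not at hcon
  have hne : ∀ z : ℂ, ‖z‖ ≤ r → G z ≠ 0 := by
    intro z hz
    rcases hz.lt_or_eq with h | h
    · exact hcon z h
    · intro h0
      have := hb z h
      rw [h0] at this
      simp at this
  have hcpt : IsCompact (Metric.closedBall (0:ℂ) r) := isCompact_closedBall _ _
  obtain ⟨z0, hz0, hmin⟩ := hcpt.exists_isMinOn ⟨0, by simp [hr.le]⟩
    (hG.norm.continuousOn (s := Metric.closedBall (0:ℂ) r))
  have hm : 0 < ‖G z0‖ := norm_pos_iff.2 (hne z0 (by simpa using hz0))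
  have huc := hcpt.uniformContinuousOn_of_continuous hG.continuousOn
  rw [Metric.uniformContinuousOn_iff] at huc
  obtain ⟨d, hd, huc⟩ := huc _ hm
  obtain ⟨n, hn⟩ := exists_nat_gt (r / d)
  have hn0 : (0:ℝ) < n := lt_trans (by positivity) hn
  have hnd : r / n < d := by
    rw [div_lt_iff₀ hd] at hn
    rw [div_lt_iff₀ hn0]; linarith
  let z : ℝ → ℂ := fun θ => r * Complex.exp (θ * Complex.I)
  have hznorm : ∀ θ, ‖z θ‖ = r := by
    intro θ
    simp [z, Complex.norm_exp_ofReal_mul_I, abs_of_pos hr]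
  have hzc : Continuous z := by fun_prop
  let p : ℕ → ℝ → ℂ := fun k θ => ((k / n : ℝ) : ℂ) * z θ
  have hpnorm : ∀ k θ, ‖p k θ‖ = k / n * r := by
    intro k θ
    simp only [p, norm_mul, hznorm, Complex.norm_real, Real.norm_eq_abs]
    rw [abs_of_nonneg (by positivity)]
  have hple : ∀ k θ, k ≤ n → ‖p k θ‖ ≤ r := by
    intro k θ hk
    rw [hpnorm]
    have : (k:ℝ) / n ≤ 1 := by
      rw [div_le_one hn0]; exact_mod_cast hk
    nlinarith
  have hpc : ∀ k, Continuous (p k) := by intro k; fun_prop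
  have hpdist : ∀ k θ, dist (p (k+1) θ) (p k θ) < d := by
    intro k θ
    rw [dist_eq_norm]
    have : p (k+1) θ - p k θ = ((1 / n : ℝ) : ℂ) * z θ := by
      simp only [p]; push_cast; ring
    rw [this, norm_mul, hznorm, Complex.norm_real, Real.norm_eq_abs, abs_of_pos (by positivity)]
    calc 1 / (n:ℝ) * r = r / n := by ring
      _ < d := hnd
  have hslit : ∀ k θ, k < n → G (p (k+1) θ) / G (p k θ) ∈ Complex.slitPlane := by
    intro k θ hk
    have h1 := huc (p (k+1) θ) (by simpa using hple (k+1) θ hk) (p k θ)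
      (by simpa using hple k θ hk.le) (hpdist k θ)
    have hk0 := hne _ (hple k θ hk.le)
    have h2 : ‖G z0‖ ≤ ‖G (p k θ)‖ := hmin (by simpa using hple k θ hk.le)
    have h3 : ‖G (p (k+1) θ) / G (p k θ) - 1‖ < 1 := by
      rw [div_sub_one hk0, norm_div, div_lt_one (norm_pos_iff.2 hk0), ← dist_eq_norm]
      linarith
    left
    have h4 := (Complex.abs_re_le_norm (G (p (k+1) θ) / G (p k θ) - 1)).trans_lt h3
    rw [Complex.sub_re, Complex.one_re] at h4
    have := (abs_lt.1 h4).1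
    linarith
  let h : ℝ → ℂ := fun θ => Complex.log (G 0) +
    ∑ k ∈ Finset.range n, Complex.log (G (p (k+1) θ) / G (p k θ))
    - Complex.log (G (z θ) * (starRingEnd ℂ) (z θ)) + Complex.log r
  have hslit2 : ∀ θ, G (z θ) * (starRingEnd ℂ) (z θ) ∈ Complex.slitPlane :=
    fun θ => Or.inl (hb _ (hznorm θ))
  have hhc : Continuous h := by
    refine Continuous.add (Continuous.sub (continuous_const.add ?_) ?_) continuous_const
    · refine continuous_finsetSum _ fun k hk => ?_
      have hk := Finset.mem_range.1 hk
      refine Continuous.clog ?_ fun θ => hslit k θ hk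
      exact (hG.comp (hpc _)).div (hG.comp (hpc _)) fun θ => hne _ (hple k θ hk.le)
    · refine Continuous.clog ?_ hslit2
      exact (hG.comp hzc).mul (Complex.continuous_conj.comp hzc)
  have hprod : ∀ θ, ∀ m ≤ n, G 0 * ∏ k ∈ Finset.range m, (G (p (k+1) θ) / G (p k θ)) = G (p m θ) := by
    intro θ m
    induction m with
    | zero => intro _; simp [p]
    | succ m ih =>
      intro hm
      rw [Finset.prod_range_succ, ← mul_assoc, ih (by omega)]
      have := hne _ (hple m θ (by omega))
      field_simp
  have hpn : ∀ θ, p n θ = z θ := by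
    intro θ
    simp only [p]
    rw [div_self hn0.ne']; simp
  have hexp : ∀ θ : ℝ, Complex.exp (h θ) = Complex.exp (θ * Complex.I) := by
    intro θ
    have hrc : (r:ℂ) ≠ 0 := by exact_mod_cast hr.ne'
    simp only [h]
    rw [Complex.exp_add, Complex.exp_sub, Complex.exp_add, Complex.exp_sum,
      Complex.exp_log (hne 0 (by simpa using hr.le)), Complex.exp_log hrc,
      Complex.exp_log (Complex.slitPlane_ne_zero (hslit2 θ))]
    rw [Finset.prod_congr rfl (fun k hk => Complex.exp_log (Complex.slitPlane_ne_zero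
      (hslit k θ (Finset.mem_range.1 hk)))), hprod θ n le_rfl, hpn]
    have hgz := hne (z θ) (hznorm θ).le
    have hz0 : z θ ≠ 0 := by
      rw [← norm_pos_iff, hznorm]; exact hr
    have hcz : (starRingEnd ℂ) (z θ) ≠ 0 := by simpa using hz0
    have hzz : z θ * (starRingEnd ℂ) (z θ) = r * r := by
      rw [Complex.mul_conj, Complex.normSq_eq_norm_sq, hznorm]; push_cast; ring
    have hzd : z θ = r * Complex.exp (θ * Complex.I) := rfl
    rw [mul_comm (G _), div_mul_eq_mul_div, div_eq_iff (mul_ne_zero hcz hgz)]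
    have : (r:ℂ) = Complex.exp (θ * Complex.I) * (starRingEnd ℂ) (z θ) := by
      apply mul_left_cancel₀ hrc
      rw [← hzz, ← mul_assoc, ← hzd]
    calc G (z θ) * r = G (z θ) * (Complex.exp (θ * Complex.I) * (starRingEnd ℂ) (z θ)) := by
          rw [← this]
      _ = _ := by ring
  have hzper : z (2 * π) = z 0 := by
    simp only [z]; push_cast; rw [Complex.exp_two_pi_mul_I]; simp
  have hper : h (2 * π) = h 0 := by
    simp only [h, p, hzper]
  let q : ℝ → ℝ := fun θ => ((h θ).im - θ) / (2 * π)
  have hqc : Continuous q := by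
    have := Complex.continuous_im.comp hhc
    exact (this.sub continuous_id).div_const _
  have hqint : ∀ θ, ∃ k : ℤ, q θ = k := by
    intro θ
    obtain ⟨k, hk⟩ := Complex.exp_eq_exp_iff_exists_int.1 (hexp θ)
    refine ⟨k, ?_⟩
    have := congrArg Complex.im hk
    simp at this
    simp only [q, this]
    field_simp; ring
  have hq2 : q (2 * π) = q 0 - 1 := by
    simp only [q, hper]; field_simp; ring
  have hivt := intermediate_value_Icc' (Real.two_pi_pos.le) (hqc.continuousOn (s := Icc 0 (2*π)))
  obtain ⟨θ, _, hθ⟩ := hivt (show q 0 - 1/2 ∈ Icc (q (2*π)) (q 0) by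
    rw [hq2]; constructor <;> linarith)
  obtain ⟨k, hk⟩ := hqint θ
  obtain ⟨j, hj⟩ := hqint 0
  rw [hk, hj] at hθ
  have : (2 * k : ℝ) = 2 * j - 1 := by linarith
  have : (2 * k : ℤ) = 2 * j - 1 := by exact_mod_cast this
  omega

lemma plane_zero (U : E2 → E2) (hU : Continuous U) (r : ℝ) (hr : 0 < r)
    (hb : ∀ x : E2, ‖x‖ = r → 0 < (inner ℝ x (U x) : ℝ)) :
    ∃ x : E2, ‖x‖ < r ∧ U x = 0 := by
  let T := Complex.orthonormalBasisOneI.repr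
  obtain ⟨z, hz, hz0⟩ := complex_zero (fun z => T.symm (U (T z)))
    (T.symm.continuous.comp (hU.comp T.continuous)) r hr (by
      intro z hz
      have h1 := hb (T z) (by simpa using hz)
      have h2 : (inner ℝ (T z) (U (T z)) : ℝ) = inner ℝ z (T.symm (U (T z))) := by
        conv_lhs => rw [← T.apply_symm_apply (U (T z))]
        rw [T.inner_map_map]
      rw [h2, Complex.inner] at h1
      show 0 < (T.symm (U (T z)) * (starRingEnd ℂ) z).re
      exact h1)
  refine ⟨T z, by simpa using hz, ?_⟩
  simpa using hz0

lemma geom (uu x : E2) (d : ℝ) (hd : 0 < d) (hd1 : d ≤ 1) (hx : x ≠ 0)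
    (H : ∀ e : E2, ‖e‖ ≤ 1 → d ^ 2 / 2 * ‖x‖ ≤ inner ℝ e x → 0 < (inner ℝ e uu : ℝ)) :
    uu ≠ 0 ∧ ‖‖uu‖⁻¹ • uu - ‖x‖⁻¹ • x‖ < d := by
  have hxn : 0 < ‖x‖ := norm_pos_iff.2 hx
  have hux : 0 < (inner ℝ (‖x‖⁻¹ • x) uu : ℝ) := by
    apply H
    · rw [norm_smul, norm_inv, norm_norm, inv_mul_cancel₀ hxn.ne']
    · rw [inner_smul_left, real_inner_self_eq_norm_sq]
      simp only [conj_trivial]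
      rw [show ‖x‖⁻¹ * ‖x‖ ^ 2 = ‖x‖ by field_simp]
      have : d ^ 2 / 2 ≤ 1 := by nlinarith
      nlinarith
  have hu0 : uu ≠ 0 := by
    rintro rfl
    simp at hux
  refine ⟨hu0, ?_⟩
  have hun : 0 < ‖uu‖ := norm_pos_iff.2 hu0
  set v := ‖uu‖⁻¹ • uu with hv
  set y := ‖x‖⁻¹ • x with hy
  have hvn : ‖v‖ = 1 := by rw [hv, norm_smul, norm_inv, norm_norm, inv_mul_cancel₀ hun.ne']
  have hyn : ‖y‖ = 1 := by rw [hy, norm_smul, norm_inv, norm_norm, inv_mul_cancel₀ hxn.ne']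
  have huv : uu = ‖uu‖ • v := by rw [hv, smul_smul, mul_inv_cancel₀ hun.ne', one_smul]
  have hxy : x = ‖x‖ • y := by rw [hy, smul_smul, mul_inv_cancel₀ hxn.ne', one_smul]
  clear_value v y
  set c : ℝ := inner ℝ y v with hc
  have hcpos : 0 < c := by
    rw [huv, inner_smul_right] at hux
    exact pos_of_mul_pos_right hux hun.le
  by_contra hcon
  push Not at hcon
  have hsq : ‖v - y‖ ^ 2 = 2 - 2 * c := by
    rw [norm_sub_sq_real, hvn, hyn, real_inner_comm, ← hc]; ring
  have hd2 : d ^ 2 ≤ 2 - 2 * c := by rw [← hsq]; gcongr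
  have hvv : (inner ℝ v v : ℝ) = 1 := by rw [real_inner_self_eq_norm_sq, hvn]; norm_num
  have hyy : (inner ℝ y y : ℝ) = 1 := by rw [real_inner_self_eq_norm_sq, hyn]; norm_num
  have := H (y - c • v) (by
      have : ‖y - c • v‖ ^ 2 = 1 - c ^ 2 := by
        rw [← real_inner_self_eq_norm_sq]
        simp only [inner_sub_left, inner_sub_right, inner_smul_left, inner_smul_right, hvv, hyy,
          conj_trivial]
        rw [real_inner_comm y v, ← hc]
        ring
      nlinarith [norm_nonneg (y - c • v)])
    (by
      conv_rhs => rw [hxy]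
      rw [inner_smul_right, inner_sub_left, inner_smul_left, hyy, real_inner_comm y v, ← hc]
      simp only [conj_trivial]
      have : d ^ 2 / 2 ≤ 1 - c * c := by nlinarith [sq_nonneg d]
      nlinarith)
  rw [huv, inner_smul_right, inner_sub_left, inner_smul_left, hvv, ← hc] at this
  simp at this

lemma barrier (u : E2 → E2) (hu : ContDiff ℝ (⊤ : ℕ∞) u) (ε M s K R η : ℝ) (V : E2 → ℝ)
    (F : E2 → E2) (x0 e : E2) (heq : ∀ x, ε ^ 2 • lap u x = V x • u x - F x)
    (hM : ∀ x, ‖u x‖ ≤ M) (he : ‖e‖ ≤ 1) (hs : 0 < ε * s) (hη : 0 ≤ η) (hR : 0 ≤ R)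
    (hV : ∀ x, ‖x - x0‖ ≤ R → (ε * s) ^ 2 ≤ V x ∧ V x ≤ K)
    (hF : ∀ x, ‖x - x0‖ ≤ R → K * η ≤ inner ℝ e (F x)) :
    η - (M + η) / Real.cosh (s * (R / 2)) * 2 ≤ inner ℝ e (u x0) := by
  have hM0 : 0 ≤ M := (norm_nonneg _).trans (hM 0)
  set B := (M + η) / Real.cosh (s * (R / 2)) with hB
  have hB0 : 0 ≤ B := div_nonneg (by linarith) (Real.cosh_pos _).le
  have hw : ∀ x, -M ≤ inner ℝ e (u x) := by
    intro x
    have h1 := abs_real_inner_le_norm e (u x)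
    have h2 : ‖e‖ * ‖u x‖ ≤ 1 * M := mul_le_mul he (hM x) (norm_nonneg _) zero_le_one
    have := (abs_le.1 (h1.trans h2)).1
    linarith
  let G : E2 → ℝ := fun x => inner ℝ e (u x) - η +
    B * (Real.cosh (s * (x 0 - x0 0)) + Real.cosh (s * (x 1 - x0 1)))
  have hGc : Continuous G := by
    have := hu.continuous
    fun_prop
  by_contra hcon
  push Not at hcon
  have hG0 : G x0 < 0 := by
    simp only [G, sub_self, mul_zero, Real.cosh_zero]; linarith
  obtain ⟨p, hp, hmin⟩ := (isCompact_closedBall x0 R).exists_isMinOn ⟨x0, by simp [hR]⟩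
    hGc.continuousOn
  have hGp : G p < 0 := lt_of_le_of_lt (hmin (by simp [hR])) hG0
  have hpR : ‖p - x0‖ ≤ R := by simpa [dist_eq_norm] using hp
  rcases hpR.lt_or_eq with hlt | heqR
  · have hloc : IsLocalMin G p := by
      refine hmin.isLocalMin (Metric.closedBall_mem_nhds_of_mem ?_)
      simpa [dist_eq_norm] using hlt
    have hdu : ∀ y, HasFDerivAt u (fderiv ℝ u y) y := fun y =>
      ((hu.differentiable (by simp)) y).hasFDerivAt
    have hdd : ∀ i, Differentiable ℝ (fun y => fderiv ℝ u y (e2basis i)) := by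
      intro i
      have h1 : ContDiff ℝ 1 (fderiv ℝ u) := hu.fderiv_right (by norm_cast)
      exact (h1.differentiable (by simp)).clm_apply (differentiable_const _)
    have hline : ∀ (i : Fin 2) (t : ℝ), HasDerivAt (fun t : ℝ => p + t • e2basis i) (e2basis i) t := by
      intro i t
      simpa using ((hasDerivAt_id t).smul_const (e2basis i)).const_add p
    have key : ∀ i : Fin 2, 0 ≤ (inner ℝ e
        (fderiv ℝ (fun y => fderiv ℝ u y (e2basis i)) p (e2basis i)) : ℝ)
        + B * (s ^ 2 * Real.cosh (s * (p i - x0 i))) := by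
      intro i
      let j : Fin 2 := 1 - i
      let g : ℝ → ℝ := fun t => inner ℝ e (u (p + t • e2basis i)) - η +
        B * (Real.cosh (s * (p i + t - x0 i)) + Real.cosh (s * (p j - x0 j)))
      let g' : ℝ → ℝ := fun t => inner ℝ e (fderiv ℝ u (p + t • e2basis i) (e2basis i)) +
        B * (Real.sinh (s * (p i + t - x0 i)) * s)
      have hgG : ∀ t, g t = G (p + t • e2basis i) := by
        intro t
        simp only [g, G, j]
        fin_cases i
        · simp [e2basis]
        · simp [e2basis, add_comm]
      have hlin : ∀ t : ℝ, HasDerivAt (fun t : ℝ => s * (p i + t - x0 i)) s t := by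
        intro t
        simpa using (((hasDerivAt_id t).const_add (p i)).sub_const (x0 i)).const_mul s
      refine second_deriv_nonneg g g' _ ?_ ?_ ?_
      · intro t
        have h1 : HasDerivAt (fun t : ℝ => u (p + t • e2basis i))
            (fderiv ℝ u (p + t • e2basis i) (e2basis i)) t :=
          (hdu _).comp_hasDerivAt t (hline i t)
        have h2 : HasDerivAt (fun t : ℝ => (inner ℝ e (u (p + t • e2basis i)) : ℝ))
            (inner ℝ e (fderiv ℝ u (p + t • e2basis i) (e2basis i))) t :=
          (innerSL ℝ e).hasFDerivAt.comp_hasDerivAt t h1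
        exact (h2.sub_const η).add (((hlin t).cosh.add_const _).const_mul B)
      · have h1 : HasDerivAt (fun t : ℝ => fderiv ℝ u (p + t • e2basis i) (e2basis i))
            (fderiv ℝ (fun y => fderiv ℝ u y (e2basis i)) (p + (0:ℝ) • e2basis i) (e2basis i)) 0 :=
          ((hdd i) _).hasFDerivAt.comp_hasDerivAt (0:ℝ) (hline i 0)
        rw [zero_smul, add_zero] at h1
        have h2 : HasDerivAt
            (fun t : ℝ => (inner ℝ e (fderiv ℝ u (p + t • e2basis i) (e2basis i)) : ℝ)) _ 0 :=
          (innerSL ℝ e).hasFDerivAt.comp_hasDerivAt (0:ℝ) h1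
        have h3 : HasDerivAt g' (inner ℝ e
            (fderiv ℝ (fun y => fderiv ℝ u y (e2basis i)) p (e2basis i)) +
            B * (Real.cosh (s * (p i + 0 - x0 i)) * s * s)) 0 :=
          h2.add ((((hlin 0).sinh).mul_const s).const_mul B)
        have h4 : B * (Real.cosh (s * (p i + 0 - x0 i)) * s * s) =
            B * (s ^ 2 * Real.cosh (s * (p i - x0 i))) := by
          rw [add_zero]; ring
        rw [h4] at h3
        exact h3
      · have hgG' : g = G ∘ (fun t : ℝ => p + t • e2basis i) := funext hgG
        rw [hgG']
        apply IsMinFilter.comp_tendsto (l := 𝓝 p)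
        · simpa [IsLocalMin] using hloc
        · have := (hline i 0).continuousAt.tendsto
          simpa using this
    have hsum := add_nonneg (key 0) (key 1)
    obtain ⟨hV1, hV2⟩ := hV p hpR
    have hFp := hF p hpR
    have hlap : (inner ℝ e (ε ^ 2 • lap u p) : ℝ) = V p * inner ℝ e (u p) - inner ℝ e (F p) := by
      rw [heq, inner_sub_right, inner_smul_right]
    rw [inner_smul_right, lap, Fin.sum_univ_two, inner_add_right] at hlap
    set C := Real.cosh (s * (p 0 - x0 0)) + Real.cosh (s * (p 1 - x0 1)) with hC
    have hC0 : 0 ≤ C := add_nonneg (Real.cosh_pos _).le (Real.cosh_pos _).le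
    have hmul := mul_nonneg (sq_nonneg ε) hsum
    have h5 : 0 ≤ V p * inner ℝ e (u p) - inner ℝ e (F p) + (ε * s) ^ 2 * (B * C) := by
      rw [← hlap, hC]
      calc (0:ℝ) ≤ _ := hmul
        _ = _ := by ring
    have hVpos : 0 < V p := lt_of_lt_of_le (by positivity) hV1
    have h6 : (ε * s) ^ 2 * (B * C) ≤ V p * (B * C) :=
      mul_le_mul_of_nonneg_right hV1 (mul_nonneg hB0 hC0)
    have h7 : V p * η ≤ K * η := mul_le_mul_of_nonneg_right hV2 hη
    have h8 : V p * G p < 0 := mul_neg_of_pos_of_neg hVpos hGp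
    have h9 : V p * G p = V p * inner ℝ e (u p) - V p * η + V p * (B * C) := by
      simp only [G, hC]; ring
    linarith
  · have hn : ‖p - x0‖ ^ 2 = (p 0 - x0 0) ^ 2 + (p 1 - x0 1) ^ 2 := by
      rw [EuclideanSpace.norm_sq_eq, Fin.sum_univ_two]; simp
    rw [heqR] at hn
    have hex : ∀ y : ℝ, R / 2 ≤ |y| → Real.cosh (s * (R / 2)) ≤ Real.cosh (s * y) := by
      intro y hy
      rw [Real.cosh_le_cosh, abs_mul, abs_mul, abs_of_nonneg (by positivity : 0 ≤ R / 2)]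
      exact mul_le_mul_of_nonneg_left hy (abs_nonneg _)
    have hcc : Real.cosh (s * (R / 2)) ≤
        Real.cosh (s * (p 0 - x0 0)) + Real.cosh (s * (p 1 - x0 1)) := by
      have c0 := Real.cosh_pos (s * (p 0 - x0 0))
      have c1 := Real.cosh_pos (s * (p 1 - x0 1))
      by_cases h0 : R / 2 ≤ |p 0 - x0 0|
      · linarith [hex _ h0]
      · by_cases h1 : R / 2 ≤ |p 1 - x0 1|
        · linarith [hex _ h1]
        · exfalso
          push Not at h0 h1
          have a0 := sq_abs (p 0 - x0 0)
          have a1 := sq_abs (p 1 - x0 1)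
          have b0 := abs_nonneg (p 0 - x0 0)
          have b1 := abs_nonneg (p 1 - x0 1)
          have : |p 0 - x0 0| ^ 2 < (R / 2) ^ 2 := by gcongr
          have : |p 1 - x0 1| ^ 2 < (R / 2) ^ 2 := by gcongr
          nlinarith
    have h1 : B * Real.cosh (s * (R / 2)) = M + η := by
      rw [hB, div_mul_cancel₀ _ (Real.cosh_pos _).ne']
    have h2 := mul_le_mul_of_nonneg_left hcc hB0
    have h3 := hw p
    have : 0 ≤ G p := by simp only [G]; linarith
    linarith

lemma asym (a : ℝ → ℝ) (hapos : ∀ ε : ℝ, 0 < ε → 0 < a ε) (β : ℝ) (hβ : 0 < β)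
    (hloga : Tendsto (fun ε : ℝ => ε ^ β * Real.log (a ε)) (𝓝[>] (0:ℝ)) (𝓝 0))
    (N q c1 : ℝ) (hN : 0 < N) (hq : 0 < q) (hc1 : 0 < c1) :
    ∀ᶠ ε in 𝓝[>] (0:ℝ), N * Real.exp (-(c1 * ε ^ (-β))) < min (q * (ε * a ε)) 1 := by
  have hpow : Tendsto (fun ε : ℝ => ε ^ β) (𝓝[>] (0:ℝ)) (𝓝 0) := by
    have := (Real.continuousAt_rpow_const 0 β (Or.inr hβ.le)).tendsto
    rw [Real.zero_rpow hβ.ne'] at this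
    exact this.mono_left nhdsWithin_le_nhds
  have hlog : Tendsto (fun ε : ℝ => ε ^ β * Real.log ε) (𝓝[>] (0:ℝ)) (𝓝 0) := by
    have := tendsto_log_mul_rpow_nhdsGT_zero hβ
    simpa [mul_comm] using this
  have h1 : Tendsto (fun ε : ℝ => ε ^ β * (Real.log N - Real.log q) - ε ^ β * Real.log ε
      - ε ^ β * Real.log (a ε)) (𝓝[>] (0:ℝ)) (𝓝 0) := by
    simpa using ((hpow.mul_const (Real.log N - Real.log q)).sub hlog).sub hloga
  have h2 : Tendsto (fun ε : ℝ => ε ^ β * Real.log N) (𝓝[>] (0:ℝ)) (𝓝 0) := by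
    simpa using hpow.mul_const (Real.log N)
  filter_upwards [h1.eventually_lt_const hc1, h2.eventually_lt_const hc1, self_mem_nhdsWithin]
    with ε e1 e2 hε
  have hε : 0 < ε := hε
  have ha := hapos ε hε
  have hp : 0 < ε ^ β := Real.rpow_pos_of_pos hε β
  have hpn : ε ^ (-β) = (ε ^ β)⁻¹ := Real.rpow_neg hε.le β
  have hNe : N * Real.exp (-(c1 * ε ^ (-β))) = Real.exp (Real.log N - c1 * (ε ^ β)⁻¹) := by
    rw [Real.exp_sub, Real.exp_log hN, hpn, Real.exp_neg]; rfl
  rw [hNe, lt_min_iff]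
  constructor
  · rw [← Real.lt_log_iff_exp_lt (by positivity), Real.log_mul hq.ne' (by positivity),
      Real.log_mul hε.ne' ha.ne']
    have : ε ^ β * (Real.log N - Real.log q - Real.log ε - Real.log (a ε)) < c1 := by linarith
    rw [mul_comm, ← lt_div_iff₀ hp, div_eq_mul_inv] at this
    linarith
  · rw [Real.exp_lt_one_iff]
    rw [mul_comm, ← lt_div_iff₀ hp, div_eq_mul_inv] at e2
    linarith

set_option maxHeartbeats 2000000 in
lemma core
    (μ : E2 → ℝ) (μrad : ℝ → ℝ) (ρ : ℝ) (f : E2 → E2) (frad : ℝ → ℝ)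
    (hμ : MuHyp μ μrad ρ) (hf : FHyp f frad)
    (ρ1 τ γ : ℝ) (hρ1 : ρ < ρ1) (hτ : 0 < τ) (hγ0 : 0 ≤ γ) (hγ1 : γ < 2/3)
    (a : ℝ → ℝ) (hapos : ∀ ε : ℝ, 0 < ε → 0 < a ε)
    (hloga : Tendsto (fun ε : ℝ => ε^(1 - 3*γ/2) * Real.log (a ε)) (𝓝[>] (0:ℝ)) (𝓝 0))
    (u : ℝ → E2 → E2) (hu : ∀ ε : ℝ, 0 < ε → IsSolution ε (a ε) μ f (u ε))
    (M : ℝ) (hM : ∀ ε : ℝ, 0 < ε → ∀ x : E2, ‖u ε x‖ ≤ M) (δ : ℝ) (hδ : 0 < δ) :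
    ∃ ε₀ : ℝ, 0 < ε₀ ∧ ∀ ε : ℝ, 0 < ε → ε < ε₀ → ∀ x : E2,
      ρ + τ * ε^γ ≤ ‖x‖ → ‖x‖ ≤ ρ1 → ∀ e : E2, ‖e‖ ≤ 1 → δ * ‖x‖ ≤ inner ℝ e x →
      0 < (inner ℝ e (u ε x) : ℝ) := by
  have hρ := hμ.rho_pos
  have hM0 : 0 ≤ M := (norm_nonneg _).trans (hM 1 one_pos 0)
  obtain ⟨κ, hκ0, hκτ, hκδ⟩ : ∃ κ : ℝ, 0 < κ ∧ κ ≤ τ / 2 ∧ κ ≤ δ * ρ / 2 :=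
    ⟨min (τ/2) (δ * ρ / 2), by positivity, min_le_left _ _, min_le_right _ _⟩
  set ρ2 := ρ1 + κ with hρ2
  have hρ2pos : 0 < ρ2 := by linarith
  have hne : (Icc ρ ρ2).Nonempty := ⟨ρ, by constructor <;> linarith⟩
  obtain ⟨m, hm0, hm⟩ : ∃ m > 0, ∀ r ∈ Icc ρ ρ2, deriv μrad r ≤ -m := by
    have hc : Continuous (deriv μrad) := hμ.smooth_rad.continuous_deriv (by simp)
    obtain ⟨r0, hr0, hmax⟩ := isCompact_Icc.exists_isMaxOn hne hc.continuousOn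
    refine ⟨-deriv μrad r0, ?_, fun r hr => ?_⟩
    · have := hμ.deriv_neg r0 (by linarith [hr0.1]); linarith
    · rw [neg_neg]; exact hmax hr
  obtain ⟨f0, hf00, hf0⟩ : ∃ f0 > 0, ∀ r ∈ Icc ρ ρ2, f0 ≤ frad r := by
    obtain ⟨r0, hr0, hmin⟩ := isCompact_Icc.exists_isMinOn hne hf.smooth_rad.continuous.continuousOn
    exact ⟨frad r0, hf.pos_rad r0 (by linarith [hr0.1]), fun r hr => hmin hr⟩
  have hmu : ∀ r ∈ Icc ρ ρ2, m * (r - ρ) ≤ - μrad r := by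
    intro r hr
    have h1 := Convex.image_sub_le_mul_sub_of_deriv_le (convex_Icc ρ ρ2)
      hμ.smooth_rad.continuous.continuousOn
      (hμ.smooth_rad.differentiable (by simp)).differentiableOn
      (C := -m) (fun x hx => hm x (interior_subset hx)) ρ ⟨le_rfl, by linarith⟩ r hr hr.1
    rw [hμ.rho_root] at h1
    linarith
  obtain ⟨C, hC⟩ := hμ.bdd
  have hC0 : 0 ≤ C := (abs_nonneg _).trans (hC 0)
  set K := M ^ 2 + C + 1 with hK
  have hK0 : 0 < K := by positivity
  set c := m * τ / 2 with hc
  have hc0 : 0 < c := by positivity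
  set c0 := f0 / ρ2 * (δ * ρ / 2) with hc0d
  have hc00 : 0 < c0 := by positivity
  have hβ : 0 < 1 - 3 * γ / 2 := by linarith
  have hasym := asym a hapos _ hβ hloga (4 * (M + 1)) (c0 / K) (√c * κ / 2) (by positivity)
    (by positivity) (by positivity)
  rw [eventually_nhdsWithin_iff, Metric.eventually_nhds_iff] at hasym
  obtain ⟨ε₀, hε₀, hasym⟩ := hasym
  refine ⟨min ε₀ 1, by positivity, ?_⟩
  intro ε hε hεlt x hx1 hx2 e he hex
  have hε1 : ε < 1 := hεlt.trans_le (min_le_right _ _)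
  have hA := hasym (y := ε) (by
    rw [Real.dist_eq, sub_zero, abs_of_pos hε]; exact hεlt.trans_le (min_le_left _ _)) hε
  have hpγ : 0 < ε ^ γ := Real.rpow_pos_of_pos hε γ
  have hpγ1 : ε ^ γ ≤ 1 := Real.rpow_le_one hε.le hε1.le hγ0
  have ha := hapos ε hε
  obtain ⟨husm, hueq⟩ := hu ε hε
  set η := min (c0 / K * (ε * a ε)) 1 with hη
  have hη0 : 0 < η := by positivity
  set s := √c * ε ^ (γ / 2) / ε with hs
  have hεs : ε * s = √c * ε ^ (γ / 2) := by rw [hs]; field_simp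
  have hεs2 : (ε * s) ^ 2 = c * ε ^ γ := by
    rw [hεs, mul_pow, Real.sq_sqrt hc0.le, ← Real.rpow_natCast, ← Real.rpow_mul hε.le]
    congr 2; push_cast; ring
  have hball : ∀ y : E2, ‖y - x‖ ≤ κ * ε ^ γ →
      ρ + τ / 2 * ε ^ γ ≤ ‖y‖ ∧ ‖y‖ ≤ ρ2 := by
    intro y hy
    have h1 := abs_norm_sub_norm_le y x
    have h2 := abs_le.1 (h1.trans hy)
    have h3 : κ * ε ^ γ ≤ τ / 2 * ε ^ γ := mul_le_mul_of_nonneg_right hκτ hpγ.le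
    have h4 : κ * ε ^ γ ≤ κ := by nlinarith
    constructor <;> [linarith [h2.1]; linarith [h2.2]]
  have hb := barrier (u ε) husm ε M s K (κ * ε ^ γ) η (fun y => ‖u ε y‖ ^ 2 - μ y)
    (fun y => (ε * a ε) • f y) x e
    (by
      intro y
      have := hueq y
      rw [sub_smul]
      rw [← sub_eq_zero, ← this]
      abel)
    (hM ε hε) he (by rw [hεs]; positivity) hη0.le (by positivity)
    (by
      intro y hy
      obtain ⟨hy1, hy2⟩ := hball y hy
      have h1 := hmu ‖y‖ ⟨by nlinarith, hy2⟩
      rw [← hμ.radial] at h1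
      have h2 : m * (τ / 2 * ε ^ γ) ≤ m * (‖y‖ - ρ) :=
        mul_le_mul_of_nonneg_left (by linarith) hm0.le
      have h3 := (abs_le.1 (hC y)).1
      have h4 : ‖u ε y‖ ^ 2 ≤ M ^ 2 := by
        have := hM ε hε y
        gcongr
      have h5 := sq_nonneg ‖u ε y‖
      constructor
      · rw [hεs2, hc]; linarith
      · rw [hK]; linarith)
    (by
      intro y hy
      obtain ⟨hy1, hy2⟩ := hball y hy
      have hyρ : ρ ≤ ‖y‖ := by nlinarith
      have hypos : 0 < ‖y‖ := by linarith
      have hy0 : y ≠ 0 := norm_pos_iff.1 hypos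
      have hKη : K * η ≤ (ε * a ε) * c0 := by
        calc K * η ≤ K * (c0 / K * (ε * a ε)) := by gcongr; exact min_le_left _ _
          _ = _ := by field_simp
      refine hKη.trans ?_
      rw [inner_smul_right]
      refine mul_le_mul_of_nonneg_left ?_ (by positivity)
      rw [hf.radial y hy0, inner_smul_right, hc0d]
      have h1 : δ * ρ / 2 ≤ inner ℝ e y := by
        have h2 : (inner ℝ e y : ℝ) = inner ℝ e x + inner ℝ e (y - x) := by
          rw [← inner_add_right]; congr 1; abel
        have h3 := abs_real_inner_le_norm e (y - x)
        have h4 : ‖e‖ * ‖y - x‖ ≤ 1 * (κ * ε ^ γ) :=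
          mul_le_mul he hy (norm_nonneg _) zero_le_one
        have h5 := (abs_le.1 (h3.trans h4)).1
        have h6 : κ * ε ^ γ ≤ κ := by nlinarith
        have h7 : δ * ρ ≤ δ * ‖x‖ := by
          apply mul_le_mul_of_nonneg_left _ hδ.le
          nlinarith
        rw [h2]; linarith
      have h2 : f0 / ρ2 ≤ frad ‖y‖ / ‖y‖ :=
        div_le_div₀ (hf.pos_rad _ hypos).le (hf0 _ ⟨hyρ, hy2⟩) hypos hy2
      exact mul_le_mul h2 h1 (by positivity) (div_nonneg (hf.pos_rad _ hypos).le hypos.le))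
  refine lt_of_lt_of_le ?_ hb
  have hexp : s * (κ * ε ^ γ / 2) = √c * κ / 2 * ε ^ (-(1 - 3 * γ / 2)) := by
    have : ε ^ (-(1 - 3 * γ / 2)) = ε ^ (γ / 2) * ε ^ γ / ε := by
      rw [← Real.rpow_add hε]
      nth_rewrite 3 [← Real.rpow_one ε]
      rw [← Real.rpow_sub hε]
      congr 1; ring
    rw [this, hs]; ring
  rw [← hexp] at hA
  set T := s * (κ * ε ^ γ / 2) with hT
  have hcosh : Real.exp T / 2 ≤ Real.cosh T := by
    rw [Real.cosh_eq]
    linarith [Real.exp_pos (-T)]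
  have hη1 : η ≤ 1 := min_le_right _ _
  have hfin : (M + η) / Real.cosh T * 2 ≤ 4 * (M + 1) * Real.exp (-T) := by
    calc (M + η) / Real.cosh T * 2 ≤ (M + 1) / (Real.exp T / 2) * 2 := by gcongr
      _ = _ := by rw [Real.exp_neg]; field_simp; ring
  linarith

/-- in the annulus `A = {ρ + τε^γ ≤ |x| ≤ ρ₁}` uniformly bounded
solutions have no zeros for small `ε`, `u/|u| → x/|x|` uniformly on `A`, and `u`
has at least one zero in the open disc `{|x| < ρ + τε^γ}`. -/
theorem statement12
    (μ : E2 → ℝ) (μrad : ℝ → ℝ) (ρ : ℝ) (f : E2 → E2) (frad : ℝ → ℝ)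
    (hμ : MuHyp μ μrad ρ) (hf : FHyp f frad)
    (ρ1 τ γ : ℝ) (hρ1 : ρ < ρ1) (hτ : 0 < τ) (hγ0 : 0 ≤ γ) (hγ1 : γ < 2/3)
    (a : ℝ → ℝ) (hapos : ∀ ε : ℝ, 0 < ε → 0 < a ε)
    (hloga : Tendsto (fun ε : ℝ => ε^(1 - 3*γ/2) * Real.log (a ε)) (𝓝[>] (0:ℝ)) (𝓝 0))
    (u : ℝ → E2 → E2) (hu : ∀ ε : ℝ, 0 < ε → IsSolution ε (a ε) μ f (u ε))
    (M : ℝ) (hM : ∀ ε : ℝ, 0 < ε → ∀ x : E2, ‖u ε x‖ ≤ M) :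
    (∃ ε₀ : ℝ, 0 < ε₀ ∧ ∀ ε : ℝ, 0 < ε → ε < ε₀ → ∀ x : E2,
      ρ + τ * ε^γ ≤ ‖x‖ → ‖x‖ ≤ ρ1 → u ε x ≠ 0) ∧
    (∀ δ : ℝ, 0 < δ → ∃ ε₁ : ℝ, 0 < ε₁ ∧ ∀ ε : ℝ, 0 < ε → ε < ε₁ → ∀ x : E2,
      ρ + τ * ε^γ ≤ ‖x‖ → ‖x‖ ≤ ρ1 →
      ‖‖u ε x‖⁻¹ • u ε x - ‖x‖⁻¹ • x‖ < δ) ∧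
    (∃ ε₂ : ℝ, 0 < ε₂ ∧ ∀ ε : ℝ, 0 < ε → ε < ε₂ →
      ∃ x : E2, ‖x‖ < ρ + τ * ε^γ ∧ u ε x = 0) := by
  have hρ := hμ.rho_pos
  have main : ∀ ρ1' : ℝ, ρ < ρ1' → ∀ δ : ℝ, 0 < δ → ∃ ε₁ : ℝ, 0 < ε₁ ∧ ∀ ε : ℝ, 0 < ε → ε < ε₁ →
      ∀ x : E2, ρ + τ * ε^γ ≤ ‖x‖ → ‖x‖ ≤ ρ1' →
      u ε x ≠ 0 ∧ ‖‖u ε x‖⁻¹ • u ε x - ‖x‖⁻¹ • x‖ < δ := by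
    intro ρ1' hρ1' δ hδ
    have hd : 0 < min δ 1 := by positivity
    obtain ⟨ε₁, hε₁, H⟩ := core μ μrad ρ f frad hμ hf ρ1' τ γ hρ1' hτ hγ0 hγ1 a hapos hloga u hu M hM
      ((min δ 1) ^ 2 / 2) (by positivity)
    refine ⟨ε₁, hε₁, fun ε hε hlt x hx1 hx2 => ?_⟩
    have hp : 0 < ε ^ γ := Real.rpow_pos_of_pos hε γ
    have hx : x ≠ 0 := by
      rw [← norm_pos_iff]
      have : 0 < τ * ε ^ γ := by positivity
      linarith
    obtain ⟨h1, h2⟩ := geom (u ε x) x (min δ 1) hd (min_le_right _ _) hx (H ε hε hlt x hx1 hx2)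
    exact ⟨h1, h2.trans_le (min_le_left _ _)⟩
  refine ⟨?_, ?_, ?_⟩
  · obtain ⟨ε₁, hε₁, H⟩ := main ρ1 hρ1 1 one_pos
    exact ⟨ε₁, hε₁, fun ε hε hlt x hx1 hx2 => (H ε hε hlt x hx1 hx2).1⟩
  · intro δ hδ
    obtain ⟨ε₁, hε₁, H⟩ := main ρ1 hρ1 δ hδ
    exact ⟨ε₁, hε₁, fun ε hε hlt x hx1 hx2 => (H ε hε hlt x hx1 hx2).2⟩
  · obtain ⟨ε₁, hε₁, H⟩ := core μ μrad ρ f frad hμ hf (ρ + τ) τ γ (by linarith) hτ hγ0 hγ1 a hapos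
      hloga u hu M hM 1 one_pos
    refine ⟨min ε₁ 1, by positivity, fun ε hε hlt => ?_⟩
    have hp : 0 < ε ^ γ := Real.rpow_pos_of_pos hε γ
    have hp1 : ε ^ γ ≤ 1 := Real.rpow_le_one hε.le (hlt.trans_le (min_le_right _ _)).le hγ0
    have hr : 0 < ρ + τ * ε ^ γ := by positivity
    refine plane_zero (u ε) (hu ε hε).1.continuous _ hr fun x hx => ?_
    have hxn : 0 < ‖x‖ := by rw [hx]; exact hr
    have h1 := H ε hε (hlt.trans_le (min_le_left _ _)) x hx.ge (by rw [hx]; nlinarith)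
      (‖x‖⁻¹ • x) (by rw [norm_smul, norm_inv, norm_norm, inv_mul_cancel₀ hxn.ne'])
      (by
        rw [inner_smul_left, real_inner_self_eq_norm_sq]
        simp only [conj_trivial]
        rw [show ‖x‖⁻¹ * ‖x‖ ^ 2 = ‖x‖ by field_simp, one_mul])
    rw [inner_smul_left] at h1
    simp only [conj_trivial] at h1
    exact pos_of_mul_pos_right h1 (by positivity)
end
end

section
/- Let v_{ε,a} be a global minimizer of E. Then for all sufficiently small ε and arbitrary a ≥ 0, the renormalized energy satisfies 𝓔(v_{ε,a}) ≤ (π|μ₁|ρ/6)|ln ε| + O(1), where μ₁ = μ_rad'(ρ). -/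
open MeasureTheory Filter Real Set
open scoped Topology ENNReal

noncomputable section

/-- The renormalized energy `𝓔(u) = E(u) + ∫_{|x|<ρ} μ²/(4ε²)`. -/
def renorm (ε a : ℝ) (μ : E2 → ℝ) (f : E2 → E2) (ρ : ℝ) (u : E2 → E2) : ℝ :=
  energy ε a μ f u + ∫ x in Metric.ball (0:E2) ρ, μ x ^ 2 / (4*ε^2)


/-- truncated square root profile -/
def gp (δ t : ℝ) : ℝ := t ^ (3/2:ℝ) * (√(δ^2+t^2))⁻¹

lemma rpow32_nonpos {t : ℝ} (ht : t ≤ 0) : t ^ (3/2:ℝ) = 0 := by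
  rcases ht.lt_or_eq with h | h
  · rw [Real.rpow_def_of_neg h]
    have : Real.cos (3/2*π) = 0 := by
      rw [show (3/2*π:ℝ) = π/2 + π by ring, Real.cos_add_pi]; simp
    simp [this]
  · rw [h]; exact Real.zero_rpow (by norm_num)

lemma gp_contDiff {δ : ℝ} (hδ : 0 < δ) : ContDiff ℝ 1 (gp δ) := by
  unfold gp
  have h1 : ContDiff ℝ 1 (fun t : ℝ => t ^ (3/2:ℝ)) := by
    have := Real.contDiff_rpow_const_of_le (p := 3/2) (n := 1) (by norm_num)
    exact_mod_cast this
  refine h1.mul (ContDiff.inv ?_ ?_)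
  · refine ContDiff.sqrt (by fun_prop) ?_
    intro x; positivity
  · intro x; positivity

lemma gp_nonpos {δ t : ℝ} (ht : t ≤ 0) : gp δ t = 0 := by
  simp [gp, rpow32_nonpos ht]

lemma gp_sq {δ t : ℝ} (hδ : 0 < δ) (ht : 0 ≤ t) : gp δ t ^ 2 = t^3/(δ^2+t^2) := by
  unfold gp
  rw [mul_pow, inv_pow, Real.sq_sqrt (by positivity), ← Real.rpow_mul_natCast ht]
  norm_num [div_eq_mul_inv]

lemma gp_deriv_sq {δ t : ℝ} (hδ : 0 < δ) (ht : 0 < t) :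
    deriv (gp δ) t ^ 2 ≤ (1/4) * (t/(δ^2+t^2)) + δ/(δ^2+t^2) := by
  have hD : 0 < δ^2+t^2 := by positivity
  have h : HasDerivAt (gp δ) ((3/2) * t^((3/2:ℝ)-1) * (√(δ^2+t^2))⁻¹ +
      t ^ (3/2:ℝ) * (-(((2*t))/(2*√(δ^2+t^2))) / (√(δ^2+t^2))^2)) t := by
    unfold gp
    have hq : HasDerivAt (fun t : ℝ => δ^2+t^2) (2*t) t := by
      simpa using (hasDerivAt_pow 2 t).const_add (δ^2)
    exact (Real.hasDerivAt_rpow_const (Or.inl ht.ne')).mul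
      ((hq.sqrt hD.ne').inv (by positivity))
  rw [h.deriv]
  set p := t^((3/2:ℝ)-1) with hp
  have hp2 : p^2 = t := by
    rw [hp, ← Real.rpow_mul_natCast ht.le]; norm_num
  have hp3 : t ^ (3/2:ℝ) = p * t := by
    rw [hp, ← Real.rpow_add_one ht.ne']; norm_num
  rw [hp3]
  set s := √(δ^2+t^2) with hs
  have hs2 : s^2 = δ^2+t^2 := Real.sq_sqrt hD.le
  have hs0 : 0 < s := by positivity
  have e : (3/2 * p * s⁻¹ + p * t * (-(2*t/(2*s))/s^2))^2 = t*((3*δ^2+t^2)^2)/(4*(δ^2+t^2)^3) := by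
    have : 3/2 * p * s⁻¹ + p * t * (-(2*t/(2*s))/s^2) = p * (3 * s^2 - 2*t^2) / (2*s^3) := by
      field_simp
      ring
    rw [this, div_pow, mul_pow, hp2, mul_pow, ← pow_mul, show 3*2 = 2*3 by rfl, pow_mul, hs2]
    congr 1 <;> ring
  rw [e, div_le_iff₀ (by positivity)]
  have : (1 / 4 * (t / (δ ^ 2 + t ^ 2)) + δ / (δ ^ 2 + t ^ 2)) * (4 * (δ ^ 2 + t ^ 2) ^ 3)
    = (t + 4 * δ) * (δ^2+t^2)^2 := by field_simp
  rw [this]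
  have : 0 ≤ δ * ((δ^2+t^2) * ((δ-t)^2)) := by positivity
  have : (t+4*δ)*(δ^2+t^2)^2 - t*(3*δ^2+t^2)^2 = 4*δ*((δ^2+t^2)^2 - t*δ*(2*δ^2+t^2)) := by ring
  have h2 : 0 ≤ 4*δ*((δ^2+t^2)^2 - t*δ*(2*δ^2+t^2)) := by
    apply mul_nonneg (by positivity)
    nlinarith [mul_nonneg hD.le (sq_nonneg (δ-t)), mul_pos ht hδ, mul_pos (mul_pos ht hδ) (pow_pos ht 2)]
  linarith

/-- radial bound -/
def KK (m : ℝ → ℝ) (δ r : ℝ) : ℝ :=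
  (1/8) * (deriv m r)^2 * (m r / (δ^2 + (m r)^2)) +
    ((1/2) * (deriv m r)^2 + 1/4) * (δ / (δ^2 + (m r)^2))

lemma lower_lin {m : ℝ → ℝ} {ρ : ℝ} (hm : ContDiff ℝ (⊤ : ℕ∞) m) (hρ : 0 < ρ) (h0 : m ρ = 0)
    (hpos : ∀ r, 0 ≤ r → r < ρ → 0 < m r) (hd : deriv m ρ < 0) :
    ∃ c > 0, ∀ r ∈ Icc 0 ρ, c * (ρ - r) ≤ m r := by
  have hdf : Differentiable ℝ m := hm.differentiable (by simp)
  have hc : ContinuousOn (dslope m ρ) (Icc 0 ρ) := by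
    intro x hx
    apply ContinuousAt.continuousWithinAt
    by_cases h : x = ρ
    · rw [h]; exact continuousAt_dslope_same.2 (hdf ρ)
    · exact (continuousAt_dslope_of_ne h).2 hm.continuous.continuousAt
  obtain ⟨r0, hr0, hmax⟩ := isCompact_Icc.exists_isMaxOn (nonempty_Icc.2 hρ.le) hc
  have hneg : ∀ r ∈ Icc 0 ρ, dslope m ρ r < 0 := by
    intro r hr
    rcases hr.2.lt_or_eq with h | h
    · rw [dslope_of_ne _ h.ne, slope_def_field, h0]
      exact div_neg_of_pos_of_neg (by simpa using hpos r hr.1 h) (by linarith)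
    · rw [h, dslope_same]; exact hd
  refine ⟨-dslope m ρ r0, by linarith [hneg r0 hr0], fun r hr => ?_⟩
  have h1 : dslope m ρ r ≤ dslope m ρ r0 := hmax hr
  have h2 : (r - ρ) * dslope m ρ r = m r := by
    have := sub_smul_dslope m ρ r
    simpa [h0] using this
  nlinarith [hr.2]

lemma oneD {m : ℝ → ℝ} {ρ : ℝ} (hm : ContDiff ℝ (⊤ : ℕ∞) m) (hρ : 0 < ρ) (h0 : m ρ = 0)
    (hpos : ∀ r, 0 ≤ r → r < ρ → 0 < m r) (hd : ∀ r, 0 < r → deriv m r < 0) :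
    ∃ C : ℝ, ∀ δ : ℝ, 0 < δ → δ < 1 →
      ∫ r in (0:ℝ)..ρ, r * KK m δ r ≤ (1/8) * (ρ * |deriv m ρ|) * |Real.log δ| + C := by
  obtain ⟨c, hc, hlow⟩ := lower_lin hm hρ h0 hpos (hd ρ hρ)
  have hdf : Differentiable ℝ m := hm.differentiable (by simp)
  have hd1 : ContDiff ℝ 1 (deriv m) := by
    have : ContDiff ℝ (1+1) m := hm.of_le (by norm_cast)
    exact (contDiff_succ_iff_deriv.1 this).2.2
  have hdc : Continuous (deriv m) := hd1.continuous
  have hmc : Continuous m := hm.continuous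
  obtain ⟨M, hM⟩ := isCompact_Icc.exists_bound_of_continuousOn (s := Icc 0 ρ) hdc.continuousOn
  have hM0 : 0 ≤ M := (norm_nonneg _).trans (hM ρ ⟨hρ.le, le_rfl⟩)
  have hw : ContDiff ℝ 1 (fun r => r * deriv m r) := contDiff_id.mul hd1
  obtain ⟨L, hL⟩ := isCompact_Icc.exists_bound_of_continuousOn (s := Icc 0 ρ)
    (hw.continuous_deriv le_rfl).continuousOn
  have hL0 : 0 ≤ L := (norm_nonneg _).trans (hL ρ ⟨hρ.le, le_rfl⟩)
  have hLip : ∀ r ∈ Icc 0 ρ, |ρ * deriv m ρ - r * deriv m r| ≤ L * (ρ - r) := by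
    intro r hr
    have := (convex_Icc 0 ρ).norm_image_sub_le_of_norm_deriv_le
      (fun x _ => hw.differentiable one_ne_zero x) hL hr (⟨hρ.le, le_rfl⟩ : ρ ∈ Icc 0 ρ)
    simpa [Real.norm_eq_abs, abs_of_nonneg (sub_nonneg.2 hr.2)] using this
  set W := ρ * |deriv m ρ| with hW
  have hW' : W = -(ρ * deriv m ρ) := by rw [hW, abs_of_neg (hd ρ hρ)]; ring
  have hWp : 0 ≤ W := by positivity
  set A := ρ * ((1/2)*M^2 + 1/4) with hA
  have hA0 : 0 ≤ A := by positivity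
  set B := (1/8) * (L * M / c) with hB
  have hB0 : 0 ≤ B := by positivity
  refine ⟨(1/16) * W * Real.log (1 + (m 0)^2) + B * ρ + A * (π/2) / c, fun δ hδ hδ1 => ?_⟩
  have hD : ∀ r, 0 < δ^2 + (m r)^2 := fun r => by positivity
  -- majorant
  let Φ : ℝ → ℝ := fun r => -(1/16) * W * Real.log (δ^2 + (m r)^2) + B * r
    - A / c * Real.arctan (c * (ρ - r) / δ)
  let φ : ℝ → ℝ := fun r => -(1/16) * W * ((2 * m r * deriv m r) / (δ^2 + (m r)^2)) + B
    + A * (δ / (δ^2 + (c * (ρ - r))^2))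
  have hΦ : ∀ r, HasDerivAt Φ (φ r) r := by
    intro r
    have h1 : HasDerivAt (fun r => δ^2 + (m r)^2) (2 * m r * deriv m r) r := by
      simpa using ((hdf r).hasDerivAt.pow 2).const_add (δ^2)
    have h2 : HasDerivAt (fun r => c * (ρ - r) / δ) (-(c / δ)) r := by
      have := (((hasDerivAt_id r).const_sub ρ).const_mul c).div_const δ
      exact this.congr_deriv (by ring)
    have h3 := (((h1.log (hD r).ne').const_mul (-(1/16) * W)).add
      ((hasDerivAt_id r).const_mul B)).sub (h2.arctan.const_mul (A/c))
    refine h3.congr_deriv ?_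
    simp only [φ]
    have : 0 < δ^2 + (c * (ρ - r))^2 := by positivity
    have e : 1 + (c * (ρ - r)/δ)^2 = (δ^2 + (c * (ρ - r))^2)/δ^2 := by field_simp
    rw [e]
    field_simp
    ring
  have hφc : Continuous φ := by
    have h1 : Continuous (fun r => (2 * m r * deriv m r) / (δ^2 + (m r)^2)) :=
      Continuous.div (by fun_prop) (by fun_prop) (fun r => (hD r).ne')
    have h2 : Continuous (fun r => δ / (δ^2 + (c * (ρ - r))^2)) :=
      Continuous.div (by fun_prop) (by fun_prop) (fun r => by positivity)
    simp only [φ]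
    fun_prop
  have hKc : Continuous (fun r => r * KK m δ r) := by
    have h1 : Continuous (fun r => m r / (δ^2 + (m r)^2)) :=
      Continuous.div (by fun_prop) (by fun_prop) (fun r => (hD r).ne')
    have h2 : Continuous (fun r => δ / (δ^2 + (m r)^2)) :=
      Continuous.div (by fun_prop) (by fun_prop) (fun r => (hD r).ne')
    unfold KK
    fun_prop
  have hle : ∀ r ∈ Icc 0 ρ, r * KK m δ r ≤ φ r := by
    intro r hr
    have hl := hlow r hr
    have hr' : 0 ≤ ρ - r := sub_nonneg.2 hr.2
    have hm0 : 0 ≤ m r := le_trans (by positivity) hl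
    have hMr : |deriv m r| ≤ M := hM r hr
    have hMsq : (deriv m r)^2 ≤ M^2 := by
      rw [← sq_abs]; exact pow_le_pow_left₀ (abs_nonneg _) hMr 2
    have t1 : r * (((1/2) * (deriv m r)^2 + 1/4) * (δ / (δ^2 + (m r)^2))) ≤
        A * (δ / (δ^2 + (c * (ρ - r))^2)) := by
      rw [← mul_assoc]
      have : r * ((1/2) * (deriv m r)^2 + 1/4) ≤ A := by
        rw [hA]
        have := hr.2
        gcongr
      have h2 : δ / (δ^2 + (m r)^2) ≤ δ / (δ^2 + (c * (ρ - r))^2) := by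
        gcongr
      exact mul_le_mul this h2 (by positivity) hA0
    have t2 : (ρ * deriv m ρ - r * deriv m r) * (-deriv m r) * (m r / (δ^2 + (m r)^2)) ≤ L*M/c := by
      have h1 : (ρ * deriv m ρ - r * deriv m r) * (-deriv m r) ≤ (L * (ρ - r)) * M := by
        refine (le_abs_self _).trans ?_
        rw [abs_mul, abs_neg]
        exact mul_le_mul (hLip r hr) hMr (abs_nonneg _) (by positivity)
      have h2 : 0 ≤ m r / (δ^2 + (m r)^2) := by positivity
      refine (mul_le_mul_of_nonneg_right h1 h2).trans ?_
      have h3 : (ρ - r) * (m r / (δ^2 + (m r)^2)) ≤ 1/c := by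
        rw [← mul_div_assoc, div_le_div_iff₀ (hD r) hc]
        nlinarith [sq_nonneg δ, mul_le_mul_of_nonneg_right hl hm0]
      calc L * (ρ - r) * M * (m r / (δ^2 + (m r)^2))
          = L * M * ((ρ - r) * (m r / (δ^2 + (m r)^2))) := by ring
        _ ≤ L * M * (1/c) := by gcongr
        _ = L*M/c := by ring
    simp only [φ, KK, hB, hW']
    have e : r * (1/8 * (deriv m r)^2 * (m r / (δ^2 + (m r)^2))) =
      1/8 * ((ρ * deriv m ρ - r * deriv m r) * (-deriv m r) * (m r / (δ^2 + (m r)^2))) +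
       (-(1/16) * (-(ρ * deriv m ρ)) * ((2 * m r * deriv m r) / (δ^2 + (m r)^2))) := by ring
    rw [mul_add, e]
    linarith
  calc ∫ r in (0:ℝ)..ρ, r * KK m δ r ≤ ∫ r in (0:ℝ)..ρ, φ r :=
        intervalIntegral.integral_mono_on hρ.le (hKc.intervalIntegrable _ _)
          (hφc.intervalIntegrable _ _) hle
    _ = Φ ρ - Φ 0 := intervalIntegral.integral_eq_sub_of_hasDerivAt (fun r _ => hΦ r)
          (hφc.intervalIntegrable _ _)
    _ ≤ _ := by
        simp only [Φ, h0]
        have l1 : Real.log (δ^2 + (0:ℝ)^2) = -2 * |Real.log δ| := by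
          rw [abs_of_neg (Real.log_neg hδ hδ1)]; simp
        have l2 : Real.log (δ^2 + (m 0)^2) ≤ Real.log (1 + (m 0)^2) := by
          apply Real.log_le_log (hD 0)
          have : δ^2 ≤ 1 := pow_le_one₀ hδ.le hδ1.le
          linarith
        have l3 := (Real.arctan_lt_pi_div_two (c * (ρ - 0)/δ)).le
        have l4 := mul_le_mul_of_nonneg_left l2 hWp
        have l5 := mul_le_mul_of_nonneg_left l3 (by positivity : 0 ≤ A/c)
        rw [l1]
        simp only [sub_self, mul_zero, zero_div, Real.arctan_zero]
        have e : A * (π/2)/c = A/c * (π/2) := by ring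
        rw [e]
        linarith

lemma gradSq_mu {μ : E2 → ℝ} {m : ℝ → ℝ} {ρ : ℝ} (h : MuHyp μ m ρ) {x : E2} (hx : x ≠ 0) :
    ∑ i : Fin 2, (fderiv ℝ μ x (e2basis i))^2 = (deriv m ‖x‖)^2 := by
  have hn : 0 < ‖x‖ := norm_pos_iff.2 hx
  have h1 : HasFDerivAt (fun y : E2 => √(‖y‖^2)) _ x :=
    (hasStrictFDerivAt_norm_sq x).hasFDerivAt.sqrt (by positivity)
  have h2 : HasDerivAt m (deriv m (√(‖x‖^2))) (√(‖x‖^2)) :=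
    (h.smooth_rad.differentiable (by simp) _).hasDerivAt
  have h3 := h2.comp_hasFDerivAt x h1
  have e : (m ∘ fun y : E2 => √(‖y‖^2)) = μ := by
    funext y; simp [h.radial y]
  rw [e] at h3
  rw [h3.fderiv]
  have hs : ‖x‖^2 = (x 0)^2 + (x 1)^2 := by
    simp [EuclideanSpace.norm_sq_eq]
  simp only [Real.sqrt_sq hn.le, e2basis, Fin.sum_univ_two]
  simp [EuclideanSpace.inner_single_right]
  field_simp
  rw [hs]

lemma mu_pos {μ : E2 → ℝ} {m : ℝ → ℝ} {ρ : ℝ} (h : MuHyp μ m ρ) :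
    ∀ r, 0 ≤ r → r < ρ → 0 < m r := by
  intro r hr hrρ
  have ha : StrictAntiOn m (Ici 0) := by
    apply strictAntiOn_of_deriv_neg (convex_Ici 0) h.smooth_rad.continuous.continuousOn
    intro x hx
    rw [interior_Ici] at hx
    exact h.deriv_neg x hx
  have := ha hr h.rho_pos.le hrρ
  rwa [h.rho_root] at this

lemma mu_nonpos {μ : E2 → ℝ} {m : ℝ → ℝ} {ρ : ℝ} (h : MuHyp μ m ρ) :
    ∀ r, ρ ≤ r → m r ≤ 0 := by
  intro r hrρ
  have ha : StrictAntiOn m (Ici 0) := by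
    apply strictAntiOn_of_deriv_neg (convex_Ici 0) h.smooth_rad.continuous.continuousOn
    intro x hx
    rw [interior_Ici] at hx
    exact h.deriv_neg x hx
  have := ha.antitoneOn h.rho_pos.le (h.rho_pos.le.trans hrρ) hrρ
  rwa [h.rho_root] at this

lemma gp_deriv_nonpos {δ t : ℝ} (ht : t ≤ 0) : deriv (gp δ) t = 0 := by
  apply IsLocalMin.deriv_eq_zero
  refine Filter.Eventually.of_forall fun s => ?_
  rw [gp_nonpos ht]
  rcases le_total s 0 with h | h
  · rw [gp_nonpos h]
  · unfold gp; positivity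

/-- the competitor -/
def comp (δ : ℝ) (μ : E2 → ℝ) (x : E2) : E2 := gp δ (μ x) • e2basis 0

lemma norm_e0 : ‖e2basis 0‖ = 1 := by simp [e2basis]

lemma norm_comp_sq (δ : ℝ) (μ : E2 → ℝ) (x : E2) : ‖comp δ μ x‖^2 = gp δ (μ x)^2 := by
  simp [comp, norm_smul, norm_e0]

lemma comp_contDiff {δ : ℝ} (hδ : 0 < δ) {μ : E2 → ℝ} (h : ContDiff ℝ (⊤ : ℕ∞) μ) :
    ContDiff ℝ 1 (comp δ μ) := by
  have h1 : ContDiff ℝ 1 μ := h.of_le (by norm_cast)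
  exact ((gp_contDiff hδ).comp h1).smul contDiff_const

lemma gradSq_comp {δ : ℝ} (hδ : 0 < δ) {μ : E2 → ℝ} (h : ContDiff ℝ (⊤ : ℕ∞) μ) (x : E2) :
    gradSq (comp δ μ) x = (deriv (gp δ) (μ x))^2 * ∑ i : Fin 2, (fderiv ℝ μ x (e2basis i))^2 := by
  have h1 : HasFDerivAt μ (fderiv ℝ μ x) x := (h.differentiable (by simp) x).hasFDerivAt
  have h2 : HasDerivAt (gp δ) (deriv (gp δ) (μ x)) (μ x) :=
    ((gp_contDiff hδ).differentiable one_ne_zero _).hasDerivAt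
  have h3 := (h2.comp_hasFDerivAt x h1).smul_const (e2basis 0)
  have h4 : fderiv ℝ (comp δ μ) x = _ := h3.fderiv
  unfold gradSq
  rw [h4, Finset.mul_sum]
  refine Finset.sum_congr rfl fun i _ => ?_
  simp [norm_smul, norm_e0, mul_pow]

lemma gradSq_neg (u : E2 → E2) (x : E2) : gradSq (fun y => - u y) x = gradSq u x := by
  simp [gradSq, fderiv_fun_neg]

lemma comp_cs {μ : E2 → ℝ} {m : ℝ → ℝ} {ρ : ℝ} (h : MuHyp μ m ρ) (δ : ℝ) :
    HasCompactSupport (comp δ μ) := by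
  apply HasCompactSupport.intro (isCompact_closedBall (0:E2) ρ)
  intro x hx
  have : ρ < ‖x‖ := by simpa using hx
  simp [comp, gp_nonpos (by rw [h.radial]; exact mu_nonpos h _ this.le : μ x ≤ 0)]

lemma memH1_of {u : E2 → E2} (h : ContDiff ℝ 1 u) (hc : HasCompactSupport u) : MemH1 u :=
  ⟨h.differentiable one_ne_zero, h.continuous.memLp_of_hasCompactSupport hc,
    (h.continuous_fderiv one_ne_zero).memLp_of_hasCompactSupport (hc.fderiv ℝ)⟩

/-- the part of the energy density without forcing -/
def dens (ε : ℝ) (μ : E2 → ℝ) (u : E2 → E2) (x : E2) : ℝ :=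
  (1/2) * gradSq u x - (1/(2*ε^2)) * μ x * ‖u x‖^2 + (1/(4*ε^2)) * ‖u x‖^4

lemma gradSq_cont {u : E2 → E2} (h : ContDiff ℝ 1 u) : Continuous (gradSq u) := by
  have := h.continuous_fderiv one_ne_zero
  unfold gradSq
  fun_prop

lemma gradSq_zero {u : E2 → E2} {x : E2} (hx : x ∉ tsupport u) : gradSq u x = 0 := by
  have : fderiv ℝ u x = 0 := by
    by_contra hne
    exact hx (support_fderiv_subset ℝ hne)
  simp [gradSq, this]

lemma dens_int {ε : ℝ} {μ : E2 → ℝ} {u : E2 → E2} (h : ContDiff ℝ 1 u) (hc : HasCompactSupport u)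
    (hμ : Continuous μ) : Integrable (dens ε μ u) := by
  apply Continuous.integrable_of_hasCompactSupport
  · have := gradSq_cont h
    have := h.continuous
    unfold dens
    fun_prop
  · apply HasCompactSupport.intro hc
    intro x hx
    simp [dens, gradSq_zero hx, image_eq_zero_of_notMem_tsupport hx]

lemma inner_int {u f : E2 → E2} (h : Continuous u) (hc : HasCompactSupport u)
    (hf : Continuous f) : Integrable (fun x => (inner ℝ (f x) (u x) : ℝ)) := by
  apply Continuous.integrable_of_hasCompactSupport
  · fun_prop
  · apply HasCompactSupport.intro hc
    intro x hx
    simp [image_eq_zero_of_notMem_tsupport hx]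

lemma energy_le {ε a : ℝ} {μ : E2 → ℝ} {f v u : E2 → E2} (hv : IsMinimizer ε a μ f v)
    (h : ContDiff ℝ 1 u) (hc : HasCompactSupport u) (hμ : Continuous μ) (hf : Continuous f) :
    energy ε a μ f v ≤ ∫ x, dens ε μ u x := by
  have hI := (inner_int h.continuous hc hf).const_mul (a/ε)
  have hD := dens_int (ε := ε) h hc hμ
  have e1 := hv.2 u (memH1_of h hc)
  have e2 := hv.2 (fun x => - u x) (memH1_of h.neg hc.neg)
  have f1 : energy ε a μ f u = (∫ x, dens ε μ u x) - ∫ x, (a/ε) * (inner ℝ (f x) (u x) : ℝ) :=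
    integral_sub hD hI
  have f2 : energy ε a μ f (fun x => - u x)
      = (∫ x, dens ε μ u x) + ∫ x, (a/ε) * (inner ℝ (f x) (u x) : ℝ) := by
    rw [← integral_add hD hI]
    unfold energy
    congr 1
    funext x
    simp [dens, gradSq_neg]
  linarith

lemma ball_integral {K : ℝ → ℝ} {ρ : ℝ} (hρ : 0 < ρ) :
    ∫ x in Metric.ball (0:E2) ρ, K ‖x‖ = 2 * π * ∫ r in (0:ℝ)..ρ, r * K r := by
  have e : ∫ x in Metric.ball (0:E2) ρ, K ‖x‖ = ∫ x : E2, (Iio ρ).indicator K ‖x‖ := by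
    rw [← integral_indicator Metric.isOpen_ball.measurableSet]
    congr 1
    funext x
    by_cases hx : ‖x‖ < ρ <;> simp [indicator, hx]
  have hv : (volume : Measure E2).real (Metric.ball 0 1) = π := by
    simp [Measure.real, EuclideanSpace.volume_ball_fin_two, Real.pi_pos.le]
  rw [e, integral_fun_norm_addHaar, hv, intervalIntegral.integral_of_le hρ.le,
    integral_Ioc_eq_integral_Ioo]
  have e2 : ∫ y in Ioi (0:ℝ), y ^ (Module.finrank ℝ E2 - 1) • (Iio ρ).indicator K y
      = ∫ r in Ioo 0 ρ, r * K r := by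
    rw [show Ioo 0 ρ = Ioi 0 ∩ Iio ρ from rfl, ← setIntegral_indicator measurableSet_Iio]
    congr 1
    funext y
    by_cases hy : y < ρ <;> simp [indicator, hy]
  rw [e2]
  simp
  ring

lemma KK_cont {m : ℝ → ℝ} (hm : ContDiff ℝ (⊤ : ℕ∞) m) {δ : ℝ} (hδ : 0 < δ) :
    Continuous (KK m δ) := by
  have hdc : Continuous (deriv m) := hm.continuous_deriv (by norm_cast)
  have hmc : Continuous m := hm.continuous
  have h1 : Continuous (fun r => m r / (δ^2 + (m r)^2)) :=
    Continuous.div (by fun_prop) (by fun_prop) (fun r => by positivity)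
  have h2 : Continuous (fun r => δ / (δ^2 + (m r)^2)) :=
    Continuous.div (by fun_prop) (by fun_prop) (fun r => by positivity)
  unfold KK
  fun_prop

lemma pointwise {μ : E2 → ℝ} {m : ℝ → ℝ} {ρ : ℝ} (h : MuHyp μ m ρ) {ε δ : ℝ} (hδ : 0 < δ)
    (hε : ε^2 = δ^3) {x : E2} (hx : x ≠ 0) (hxρ : ‖x‖ < ρ) :
    dens ε μ (comp δ μ) x + μ x ^ 2 / (4*ε^2) ≤ KK m δ ‖x‖ := by
  have ht : 0 < μ x := by rw [h.radial]; exact mu_pos h _ (norm_nonneg _) hxρ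
  unfold dens KK
  rw [gradSq_comp hδ h.smooth, gradSq_mu h hx, ← h.radial, show ‖comp δ μ x‖^4 = (‖comp δ μ x‖^2)^2 by ring,
    norm_comp_sq, gp_sq hδ ht.le, hε]
  have hg := gp_deriv_sq hδ ht
  set t := μ x
  have hD : 0 < δ^2+t^2 := by positivity
  have h1 := mul_le_mul_of_nonneg_right hg (sq_nonneg (deriv m ‖x‖))
  have h2 : - (1/(2*δ^3)) * t * (t^3/(δ^2+t^2)) + (1/(4*δ^3)) * (t^3/(δ^2+t^2))^2 + t^2/(4*δ^3)
      ≤ 1/4 * (δ/(δ^2+t^2)) := by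
    have : - (1/(2*δ^3)) * t * (t^3/(δ^2+t^2)) + (1/(4*δ^3)) * (t^3/(δ^2+t^2))^2 + t^2/(4*δ^3)
        = δ * t^2 / (4 * (δ^2+t^2)^2) := by
      field_simp
      ring
    rw [this, ← mul_div_assoc, div_le_div_iff₀ (by positivity) hD]
    nlinarith [mul_pos hδ hD, mul_pos (mul_pos hδ hD) (pow_pos hδ 2)]
  linarith

/-- upper bound for the renormalized energy of global minimizers:
`𝓔(v_{ε,a}) ≤ (π|μ₁|ρ/6)|ln ε| + O(1)` for small `ε` and arbitrary `a ≥ 0`. -/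
theorem statement13
    (μ : E2 → ℝ) (μrad : ℝ → ℝ) (ρ : ℝ) (f : E2 → E2) (frad : ℝ → ℝ)
    (hμ : MuHyp μ μrad ρ) (hf : FHyp f frad) :
    ∃ C : ℝ, ∃ ε₀ : ℝ, 0 < ε₀ ∧ ∀ ε : ℝ, 0 < ε → ε < ε₀ → ∀ a : ℝ, 0 ≤ a →
      ∀ v : E2 → E2, IsMinimizer ε a μ f v →
        renorm ε a μ f ρ v ≤ (π * |deriv μrad ρ| * ρ / 6) * |Real.log ε| + C := by
  obtain ⟨C, hC⟩ := oneD hμ.smooth_rad hμ.rho_pos hμ.rho_root (mu_pos hμ) hμ.deriv_neg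
  refine ⟨2 * π * C, 1, one_pos, fun ε hε hε1 a _ v hv => ?_⟩
  set δ := ε ^ (2/3:ℝ) with hδdef
  have hδ : 0 < δ := Real.rpow_pos_of_pos hε _
  have hδ1 : δ < 1 := Real.rpow_lt_one hε.le hε1 (by norm_num)
  have hδε : ε^2 = δ^3 := by
    rw [hδdef, ← Real.rpow_mul_natCast hε.le]; norm_num
  have hlog : Real.log δ = 2/3 * Real.log ε := Real.log_rpow hε _
  have hu := comp_contDiff hδ hμ.smooth
  have hcs := comp_cs hμ δ
  have hμc := hμ.smooth.continuous
  have h1 := energy_le hv hu hcs hμc hf.smooth.continuous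
  have hdi := dens_int (ε := ε) hu hcs hμc
  have h2 : ∫ x, dens ε μ (comp δ μ) x
      = ∫ x in Metric.ball (0:E2) ρ, dens ε μ (comp δ μ) x := by
    refine (setIntegral_eq_integral_of_forall_compl_eq_zero fun x hx => ?_).symm
    have hx' : ρ ≤ ‖x‖ := by simpa using hx
    have ht : μ x ≤ 0 := by rw [hμ.radial]; exact mu_nonpos hμ _ hx'
    have h0 : comp δ μ x = 0 := by simp [comp, gp_nonpos ht]
    simp [dens, gradSq_comp hδ hμ.smooth, gp_deriv_nonpos ht, h0]
  have hbi : ∀ {F : E2 → ℝ}, Continuous F → IntegrableOn F (Metric.ball (0:E2) ρ) := fun hF =>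
    (hF.continuousOn.integrableOn_compact (isCompact_closedBall (0:E2) ρ)).mono_set
      Metric.ball_subset_closedBall
  have h3 : IntegrableOn (fun x => μ x ^ 2 / (4*ε^2)) (Metric.ball (0:E2) ρ) := hbi (by fun_prop)
  have h4 : IntegrableOn (fun x => KK μrad δ ‖x‖) (Metric.ball (0:E2) ρ) :=
    hbi ((KK_cont hμ.smooth_rad hδ).comp continuous_norm)
  have h5 : (∫ x in Metric.ball (0:E2) ρ, dens ε μ (comp δ μ) x) +
      ∫ x in Metric.ball (0:E2) ρ, μ x ^ 2 / (4*ε^2) ≤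
      ∫ x in Metric.ball (0:E2) ρ, KK μrad δ ‖x‖ := by
    rw [← integral_add hdi.integrableOn h3]
    apply setIntegral_mono_on_ae (hdi.integrableOn.add h3) h4 Metric.isOpen_ball.measurableSet
    have : ∀ᵐ x : E2, x ≠ 0 := by
      simp [ae_iff]
    filter_upwards [this] with x hx hxb
    exact pointwise hμ hδ hδε hx (by simpa using hxb)
  rw [ball_integral hμ.rho_pos] at h5
  have h6 := mul_le_mul_of_nonneg_left (hC δ hδ hδ1) (by positivity : 0 ≤ 2 * π)
  have h7 : |Real.log δ| = 2/3 * |Real.log ε| := by rw [hlog, abs_mul]; norm_num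
  rw [h7] at h6
  unfold renorm
  calc _ ≤ _ := by linarith
    _ ≤ _ := h6
    _ = _ := by ring
end
end
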